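/- arXiv:1009.2931 — 4 statements merged into one kernel-verified Lean document; each statement's English description precedes it below -/
import Mathlib

section
/- Let d ≥ 0 and m ≥ 0 be integers with 2m ≤ d, and set v_m = Σ_{i=0}^{m} (−1)^i·C(m,i)·x_0^{d−2m+i}·x_1^{2(m−i)}·x_2^{i} = x_0^{d−2m}·(x_1² − x_0x_2)^m ∈ ℂ[x_0,x_1,x_2]. Then v_m ≠ 0, E(v_m) = 0, and H(v_m) = (2d − 4m)·v_m; i.e., v_m is a highest weight vector of weight 2d − 4m in the degree-d component of the symmetric algebra of V₂. -/
open MvPolynomial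

/-- The derivation `E` on `ℂ[x_0,x_1,x_2]` with `E(x_0)=0`, `E(x_1)=x_0`, `E(x_2)=2x_1`. -/
noncomputable def E2 : Derivation ℂ (MvPolynomial (Fin 3) ℂ) (MvPolynomial (Fin 3) ℂ) :=
  MvPolynomial.mkDerivation ℂ ![0, X 0, 2 * X 1]

/-- The derivation `F` on `ℂ[x_0,x_1,x_2]` with `F(x_0)=2x_1`, `F(x_1)=x_2`, `F(x_2)=0`. -/
noncomputable def F2 : Derivation ℂ (MvPolynomial (Fin 3) ℂ) (MvPolynomial (Fin 3) ℂ) :=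
  MvPolynomial.mkDerivation ℂ ![2 * X 1, X 2, 0]

/-- The derivation `H` on `ℂ[x_0,x_1,x_2]` with `H(x_0)=2x_0`, `H(x_1)=0`, `H(x_2)=−2x_2`. -/
noncomputable def H2 : Derivation ℂ (MvPolynomial (Fin 3) ℂ) (MvPolynomial (Fin 3) ℂ) :=
  MvPolynomial.mkDerivation ℂ ![2 * X 0, 0, -2 * X 2]

lemma E2_X_zero : E2 (X 0) = 0 := by simp [E2, mkDerivation_X]

lemma E2_X_one : E2 (X 1) = X 0 := by simp [E2, mkDerivation_X]

lemma E2_X_two : E2 (X 2) = 2 * X 1 := by simp [E2, mkDerivation_X]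

lemma H2_X_zero : H2 (X 0) = 2 * X 0 := by simp [H2, mkDerivation_X]

lemma H2_X_one : H2 (X 1) = 0 := by simp [H2, mkDerivation_X]

lemma H2_X_two : H2 (X 2) = -2 * X 2 := by simp [H2, mkDerivation_X]

lemma E2_discriminant : E2 (X 1 ^ 2 - X 0 * X 2) = 0 := by
  simp only [map_sub, Derivation.leibniz, Derivation.leibniz_pow, E2_X_zero, E2_X_one, E2_X_two,
    smul_eq_mul, nsmul_eq_mul]
  push_cast
  ring

lemma H2_discriminant : H2 (X 1 ^ 2 - X 0 * X 2) = 0 := by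
  simp only [map_sub, Derivation.leibniz, Derivation.leibniz_pow, H2_X_zero, H2_X_one, H2_X_two,
    smul_eq_mul, nsmul_eq_mul]
  ring

lemma H2_X_zero_pow (n : ℕ) : H2 (X 0 ^ n) = ((2 * n : ℕ) : ℂ) • X 0 ^ n := by
  rw [Derivation.leibniz_pow, H2_X_zero, smul_eq_C_mul, map_natCast, smul_eq_mul, nsmul_eq_mul]
  cases n with
  | zero => simp
  | succ k => push_cast [Nat.add_sub_cancel]; ring

lemma discriminant_ne_zero : (X 1 ^ 2 - X 0 * X 2 : MvPolynomial (Fin 3) ℂ) ≠ 0 := by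
  intro h
  simpa using congrArg (eval ![0, 1, 0]) h

lemma sum_eq_X_zero_pow_mul_discriminant_pow (n m : ℕ) :
    ∑ i ∈ Finset.range (m + 1), ((-1 : ℂ) ^ i * (m.choose i : ℂ)) •
      (X 0 ^ (n + i) * X 1 ^ (2 * (m - i)) * X 2 ^ i : MvPolynomial (Fin 3) ℂ) =
    X 0 ^ n * (X 1 ^ 2 - X 0 * X 2) ^ m := by
  rw [sub_eq_neg_add, add_pow, Finset.mul_sum]
  refine Finset.sum_congr rfl fun i _ => ?_
  rw [smul_eq_C_mul, neg_pow (X 0 * X 2), mul_pow (X 0), pow_add, pow_mul]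
  simp only [map_mul, map_pow, map_neg, map_one, map_natCast]
  ring

/-- For `2m ≤ d`, the vector `v_m = Σ_{i=0}^m (−1)^i C(m,i) x_0^{d−2m+i} x_1^{2(m−i)} x_2^i`
equals `x_0^{d−2m}(x_1² − x_0x_2)^m`, is nonzero, and is a highest weight vector of weight
`2d − 4m`: `E(v_m) = 0` and `H(v_m) = (2d−4m)·v_m`. -/
theorem highest_weight_vectors (d m : ℕ) (hm : 2 * m ≤ d)
    (v : MvPolynomial (Fin 3) ℂ)
    (hv : v = ∑ i ∈ Finset.range (m + 1),
        ((-1 : ℂ) ^ i * (m.choose i : ℂ)) •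
          (X 0 ^ (d - 2 * m + i) * X 1 ^ (2 * (m - i)) * X 2 ^ i)) :
    v = X 0 ^ (d - 2 * m) * (X 1 ^ 2 - X 0 * X 2) ^ m ∧
    v ≠ 0 ∧ E2 v = 0 ∧ H2 v = ((2 * d - 4 * m : ℕ) : ℂ) • v := by
  have hfac : v = X 0 ^ (d - 2 * m) * (X 1 ^ 2 - X 0 * X 2) ^ m :=
    hv.trans (sum_eq_X_zero_pow_mul_discriminant_pow _ _)
  refine ⟨hfac, ?_, ?_, ?_⟩
  · rw [hfac]
    exact mul_ne_zero (pow_ne_zero _ (X_ne_zero 0)) (pow_ne_zero _ discriminant_ne_zero)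
  · rw [hfac]
    simp [Derivation.leibniz, Derivation.leibniz_pow, E2_discriminant, E2_X_zero]
  · rw [hfac, Derivation.leibniz, Derivation.leibniz_pow, H2_discriminant, H2_X_zero_pow,
      show 2 * d - 4 * m = 2 * (d - 2 * m) by lia]
    simp only [smul_zero, zero_add, smul_eq_mul, mul_zero, mul_smul_comm]
    rw [mul_comm (_ ^ m)]
end

section
/- Let N ≥ 0 be an integer and λ ∈ ℤ. The ℂ-vector space of homogeneous polynomials f ∈ ℂ[x_0,x_1,x_2] of degree N satisfying E(f) = 0 and H(f) = λ·f has dimension 1 if λ = 2N − 4i for some integer i with 0 ≤ 2i ≤ N, and dimension 0 otherwise. (Equivalently, the degree-N component of the symmetric algebra of V₂ decomposes as ⊕_{i=0}^{⌊N/2⌋} V_{2N−4i} as an sl₂(ℂ)-module.) -/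
open MvPolynomial

/-- The exponent of the monomial `x_0 ^ a * x_1 ^ b * x_2 ^ c`. -/
noncomputable def exponent (a b c : ℕ) : Fin 3 →₀ ℕ :=
  Finsupp.single 0 a + Finsupp.single 1 b + Finsupp.single 2 c

lemma exponent_surj (m : Fin 3 →₀ ℕ) : exponent (m 0) (m 1) (m 2) = m := by
  ext i
  fin_cases i <;> simp [exponent]

lemma E2_apply (f : MvPolynomial (Fin 3) ℂ) :
    E2 f = X 0 * pderiv 1 f + (2 : ℂ) • (X 1 * pderiv 2 f) := by
  have h : E2 = (X 0 : MvPolynomial (Fin 3) ℂ) • pderiv (R := ℂ) (1 : Fin 3)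
      + (2 : ℂ) • ((X 1 : MvPolynomial (Fin 3) ℂ) • pderiv (R := ℂ) (2 : Fin 3)) := by
    ext1 i
    fin_cases i <;> simp [E2, mkDerivation_X, pderiv_X, two_smul, two_mul]
  rw [h]
  simp

lemma H2_apply (f : MvPolynomial (Fin 3) ℂ) :
    H2 f = (2 : ℂ) • (X 0 * pderiv 0 f) - (2 : ℂ) • (X 2 * pderiv 2 f) := by
  have h : H2 = (2 : ℂ) • ((X 0 : MvPolynomial (Fin 3) ℂ) • pderiv (R := ℂ) (0 : Fin 3))
      - (2 : ℂ) • ((X 2 : MvPolynomial (Fin 3) ℂ) • pderiv (R := ℂ) (2 : Fin 3)) := by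
    ext1 i
    fin_cases i <;> simp [H2, mkDerivation_X, pderiv_X, two_smul, two_mul]
  rw [h]
  simp

lemma coeff_X_mul_pderiv (f : MvPolynomial (Fin 3) ℂ) (i : Fin 3) (m : Fin 3 →₀ ℕ) :
    coeff m (X i * pderiv i f) = m i * coeff m f := by
  classical
  rw [coeff_X_mul']
  split_ifs with h
  · have hm : Finsupp.single i 1 ≤ m := by
      rw [Finsupp.single_le_iff]
      exact Nat.one_le_iff_ne_zero.2 (Finsupp.mem_support_iff.1 h)
    rw [coeff_pderiv, tsub_add_cancel_of_le hm]
    have h1 : 1 ≤ m i := Nat.one_le_iff_ne_zero.2 (Finsupp.mem_support_iff.1 h)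
    simp [Nat.cast_sub h1, mul_comm]
  · simp [Finsupp.notMem_support_iff.1 h]

lemma coeff_H2 (f : MvPolynomial (Fin 3) ℂ) (m : Fin 3 →₀ ℕ) :
    coeff m (H2 f) = (2 * (m 0 : ℂ) - 2 * (m 2 : ℂ)) * coeff m f := by
  rw [H2_apply, coeff_sub, coeff_smul, coeff_smul, coeff_X_mul_pderiv, coeff_X_mul_pderiv,
    smul_eq_mul, smul_eq_mul]
  ring

lemma coeff_exponent_E2 (f : MvPolynomial (Fin 3) ℂ) (a b c : ℕ) :
    coeff (exponent (a + 1) (b + 1) c) (E2 f) =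
      (b + 2) * coeff (exponent a (b + 2) c) f
        + 2 * (c + 1) * coeff (exponent (a + 1) b (c + 1)) f := by
  have h0 : exponent (a + 1) (b + 1) c = Finsupp.single 0 1 + exponent a (b + 1) c := by
    ext i; fin_cases i <;> simp [exponent, add_comm]
  have h1 : exponent (a + 1) (b + 1) c = Finsupp.single 1 1 + exponent (a + 1) b c := by
    ext i; fin_cases i <;> simp [exponent, add_comm]
  have h2 : exponent a (b + 1) c + Finsupp.single 1 1 = exponent a (b + 2) c := by
    ext i; fin_cases i <;> simp [exponent]
  have h3 : exponent (a + 1) b c + Finsupp.single 2 1 = exponent (a + 1) b (c + 1) := by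
    ext i; fin_cases i <;> simp [exponent]
  rw [E2_apply, coeff_add, coeff_smul]
  nth_rewrite 1 [h0]
  rw [h1, coeff_X_mul, coeff_X_mul, coeff_pderiv, coeff_pderiv, h2, h3]
  simp [exponent]
  ring

lemma coeff_exponent_zero_left_E2 (f : MvPolynomial (Fin 3) ℂ) (b c : ℕ) :
    coeff (exponent 0 (b + 1) c) (E2 f) = 2 * (c + 1) * coeff (exponent 0 b (c + 1)) f := by
  classical
  have h1 : exponent 0 (b + 1) c = Finsupp.single 1 1 + exponent 0 b c := by
    ext i; fin_cases i <;> simp [exponent, add_comm]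
  have h3 : exponent 0 b c + Finsupp.single 2 1 = exponent 0 b (c + 1) := by
    ext i; fin_cases i <;> simp [exponent]
  have h0 : (0 : Fin 3) ∉ (exponent 0 (b + 1) c).support := by simp [exponent]
  rw [E2_apply, coeff_add, coeff_smul, coeff_X_mul', if_neg h0, h1, coeff_X_mul, coeff_pderiv, h3]
  simp [exponent]
  ring

lemma coeff_exponent_zero_middle_E2 (f : MvPolynomial (Fin 3) ℂ) (a c : ℕ) :
    coeff (exponent (a + 1) 0 c) (E2 f) = coeff (exponent a 1 c) f := by
  classical
  have h0 : exponent (a + 1) 0 c = Finsupp.single 0 1 + exponent a 0 c := by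
    ext i; fin_cases i <;> simp [exponent, add_comm]
  have h2 : exponent a 0 c + Finsupp.single 1 1 = exponent a 1 c := by
    ext i; fin_cases i <;> simp [exponent]
  have h1 : (1 : Fin 3) ∉ (exponent (a + 1) 0 c).support := by simp [exponent]
  rw [E2_apply, coeff_add, coeff_smul, coeff_X_mul' _ 1, if_neg h1, h0, coeff_X_mul,
    coeff_pderiv, h2]
  simp [exponent]

section Kernel

variable {f : MvPolynomial (Fin 3) ℂ}

lemma coeff_exponent_eq_zero_iff (hf : E2 f = 0) (a b c : ℕ) :
    coeff (exponent (a + 1) b (c + 1)) f = 0 ↔ coeff (exponent a (b + 2) c) f = 0 := by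
  have h := coeff_exponent_E2 f a b c
  rw [hf, coeff_zero] at h
  have hb : (b : ℂ) + 2 ≠ 0 := by exact_mod_cast (by omega : b + 2 ≠ 0)
  have hc : (c : ℂ) + 1 ≠ 0 := by exact_mod_cast (by omega : c + 1 ≠ 0)
  constructor <;> intro h' <;> simpa [h', hb, hc] using h

lemma coeff_exponent_add_eq_zero_iff (hf : E2 f = 0) (a b c : ℕ) :
    coeff (exponent (a + c) b c) f = 0 ↔ coeff (exponent a (b + 2 * c) 0) f = 0 := by
  induction c generalizing b with
  | zero => simp
  | succ c ih =>
    rw [← add_assoc, coeff_exponent_eq_zero_iff hf, ih,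
      show b + 2 + 2 * c = b + 2 * (c + 1) by ring]

lemma coeff_exponent_eq_zero_of_lt (hf : E2 f = 0) {a c : ℕ} (b : ℕ) (h : a < c) :
    coeff (exponent a b c) f = 0 := by
  obtain ⟨c, rfl⟩ : ∃ d, c = d + 1 := ⟨c - 1, by omega⟩
  induction a generalizing b c with
  | zero =>
    have h' := coeff_exponent_zero_left_E2 f b c
    have hc : (c : ℂ) + 1 ≠ 0 := by exact_mod_cast (by omega : c + 1 ≠ 0)
    simpa [hf, hc] using h'
  | succ a ih =>
    obtain ⟨c, rfl⟩ : ∃ d, c = d + 1 := ⟨c - 1, by omega⟩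
    exact (coeff_exponent_eq_zero_iff hf a b (c + 1)).2 (ih (b + 2) c (by omega))

lemma coeff_exponent_eq_zero_of_odd (hf : E2 f = 0) (a j c : ℕ) :
    coeff (exponent a (2 * j + 1) c) f = 0 := by
  induction j generalizing a c with
  | zero =>
    rw [← coeff_exponent_zero_middle_E2, hf, coeff_zero]
  | succ j ih =>
    exact (coeff_exponent_eq_zero_iff hf a (2 * j + 1) c).1 (ih (a + 1) (c + 1))

end Kernel

/-- The space of highest weight vectors of degree `N` and weight `lam`. -/
noncomputable abbrev highestWeightSpace (N : ℕ) (lam : ℤ) :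
    Submodule ℂ (MvPolynomial (Fin 3) ℂ) :=
  homogeneousSubmodule (Fin 3) ℂ N ⊓ LinearMap.ker E2.toLinearMap ⊓
    LinearMap.ker (H2.toLinearMap - (lam : ℂ) • LinearMap.id)

lemma mem_highestWeightSpace {N : ℕ} {lam : ℤ} {f : MvPolynomial (Fin 3) ℂ} :
    f ∈ highestWeightSpace N lam ↔ f.IsHomogeneous N ∧ E2 f = 0 ∧ H2 f = (lam : ℂ) • f := by
  simp [highestWeightSpace, sub_eq_zero, and_assoc]

lemma exists_coeff_ne_zero {N : ℕ} {lam : ℤ} {f : MvPolynomial (Fin 3) ℂ}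
    (hf : f ∈ highestWeightSpace N lam) (h0 : f ≠ 0) :
    ∃ i : ℕ, 2 * i ≤ N ∧ lam = 2 * (N : ℤ) - 4 * (i : ℤ) ∧
      coeff (exponent (N - 2 * i) (2 * i) 0) f ≠ 0 := by
  obtain ⟨hN, hE, hH⟩ := mem_highestWeightSpace.1 hf
  obtain ⟨m, hm⟩ := ne_zero_iff.1 h0
  have hdeg : m 0 + m 1 + m 2 = N := by
    have := hN hm
    simpa [Finsupp.weight_apply, Finsupp.sum_fintype, Fin.sum_univ_three] using this
  have hwt : (2 * m 0 - 2 * m 2 : ℤ) = lam := by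
    have h := congrArg (coeff m) hH
    rw [coeff_H2, coeff_smul, smul_eq_mul] at h
    exact_mod_cast mul_right_cancel₀ hm h
  rw [← exponent_surj m] at hm
  generalize m 0 = a at *
  generalize m 1 = b at *
  generalize m 2 = c at *
  have hca : c ≤ a := not_lt.1 fun h => hm (coeff_exponent_eq_zero_of_lt hE b h)
  obtain ⟨a, rfl⟩ := Nat.exists_eq_add_of_le' hca
  obtain ⟨j, rfl | rfl⟩ := Nat.even_or_odd' b
  · refine ⟨c + j, by omega, by push_cast at *; omega, fun h => hm ?_⟩
    rw [coeff_exponent_add_eq_zero_iff hE]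
    rwa [show N - 2 * (c + j) = a by omega, show 2 * (c + j) = 2 * j + 2 * c by ring] at h
  · exact absurd (coeff_exponent_eq_zero_of_odd hE _ j c) hm

lemma exists_mem_highestWeightSpace {N i : ℕ} (hi : 2 * i ≤ N) :
    ∃ f ∈ highestWeightSpace N (2 * (N : ℤ) - 4 * (i : ℤ)), f ≠ 0 := by
  obtain ⟨k, rfl⟩ := Nat.exists_eq_add_of_le' hi
  refine ⟨X 0 ^ k * (X 1 ^ 2 - X 0 * X 2) ^ i, mem_highestWeightSpace.2 ⟨?_, ?_, ?_⟩, ?_⟩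
  · have hq : (X 1 ^ 2 - X 0 * X 2 : MvPolynomial (Fin 3) ℂ).IsHomogeneous 2 :=
      (isHomogeneous_X_pow 1 2).sub ((isHomogeneous_X ℂ 0).mul (isHomogeneous_X ℂ 2))
    exact (isHomogeneous_X_pow 0 k).mul (hq.pow i)
  · have hq : E2 (X 1 ^ 2 - X 0 * X 2) = 0 := by
      simp [E2, mkDerivation_X, Derivation.leibniz_pow]
      ring
    have hx : E2 (X 0) = 0 := by simp [E2, mkDerivation_X]
    simp [Derivation.leibniz, Derivation.leibniz_pow, hq, hx]
  · have hq : H2 (X 1 ^ 2 - X 0 * X 2) = 0 := by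
      simp [H2, mkDerivation_X, Derivation.leibniz_pow]
      ring
    have hx : H2 (X 0 ^ k) = (2 * k : ℂ) • X 0 ^ k := by
      have hx0 : H2 (X 0) = 2 * X 0 := by simp [H2, mkDerivation_X]
      rw [Derivation.leibniz_pow, hx0, smul_eq_C_mul]
      rcases k with _ | k
      · simp
      · have hC : (C 2 : MvPolynomial (Fin 3) ℂ) = 2 := map_ofNat C 2
        simp [pow_succ, hC]
        ring
    rw [Derivation.leibniz, hx, Derivation.leibniz_pow, hq]
    simp only [smul_eq_C_mul, smul_eq_mul]
    rw [show (((2 * ((k + 2 * i : ℕ) : ℤ) - 4 * (i : ℤ) : ℤ)) : ℂ) = 2 * k by push_cast; ring]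
    ring
  · intro h
    simpa using congrArg (eval ![1, 1, 0]) h

/-- The space of homogeneous polynomials of degree `N` in `ℂ[x_0,x_1,x_2]` with `E(f) = 0` and
`H(f) = λ·f` is one-dimensional if `λ = 2N − 4i` for some `0 ≤ 2i ≤ N`, and zero otherwise. -/
theorem highest_weight_space_dim (N : ℕ) (lam : ℤ) :
    ((∃ i : ℕ, 2 * i ≤ N ∧ lam = 2 * (N : ℤ) - 4 * (i : ℤ)) →
      Module.finrank ℂ
          ↥(homogeneousSubmodule (Fin 3) ℂ N ⊓ LinearMap.ker E2.toLinearMap ⊓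
            LinearMap.ker (H2.toLinearMap - (lam : ℂ) • LinearMap.id)) = 1) ∧
    (¬(∃ i : ℕ, 2 * i ≤ N ∧ lam = 2 * (N : ℤ) - 4 * (i : ℤ)) →
      Module.finrank ℂ
          ↥(homogeneousSubmodule (Fin 3) ℂ N ⊓ LinearMap.ker E2.toLinearMap ⊓
            LinearMap.ker (H2.toLinearMap - (lam : ℂ) • LinearMap.id)) = 0) := by
  refine ⟨?_, fun hlam => ?_⟩
  · rintro ⟨i, hi, rfl⟩
    obtain ⟨v, hv, hv0⟩ := exists_mem_highestWeightSpace hi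
    have key : ∀ f ∈ highestWeightSpace N (2 * (N : ℤ) - 4 * (i : ℤ)), f ≠ 0 →
        coeff (exponent (N - 2 * i) (2 * i) 0) f ≠ 0 := by
      intro f hf hf0
      obtain ⟨j, -, hj, h⟩ := exists_coeff_ne_zero hf hf0
      obtain rfl : i = j := by omega
      exact h
    have hvc := key v hv hv0
    refine (finrank_eq_one_iff_of_nonzero' (⟨v, hv⟩ : highestWeightSpace N _)
      (fun h => hv0 (congrArg Subtype.val h))).2 ?_
    rintro ⟨w, hw⟩
    refine ⟨coeff (exponent (N - 2 * i) (2 * i) 0) w / coeff (exponent (N - 2 * i) (2 * i) 0) v,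
      Subtype.ext (sub_eq_zero.1 ?_)⟩
    by_contra hne
    refine key _ (Submodule.sub_mem _ (Submodule.smul_mem _ _ hv) hw) hne ?_
    rw [coeff_sub, coeff_smul, smul_eq_mul, div_mul_cancel₀ _ hvc, sub_self]
  · have hbot : highestWeightSpace N lam = ⊥ := by
      refine (Submodule.eq_bot_iff _).2 fun f hf => ?_
      by_contra hf0
      obtain ⟨i, hi, hi', -⟩ := exists_coeff_ne_zero hf hf0
      exact hlam ⟨i, hi, hi'⟩
    change Module.finrank ℂ (highestWeightSpace N lam) = 0
    rw [hbot, finrank_bot]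
end

section
/- Let d ≥ 1 and let W_d ⊆ ℂ[x_0,x_1,x_2] be the ℂ-linear span of {F^m(x_0^d) : m ≥ 0}. Then for every integer k ≥ 2, every homogeneous polynomial of degree k·d in ℂ[x_0,x_1,x_2] is a ℂ-linear combination of products w_1·w_2⋯w_k with w_1,…,w_k ∈ W_d. (I.e., the degree-k component of the subalgebra A(2,d) generated by the copy of V_{2d} inside the Veronese algebra V(2,d) equals the full degree-k component of V(2,d) for k ≥ 2.) -/
open MvPolynomial

/-- The polynomial `(x_0 + 2 x_1 t + x_2 t²)` in the variable `t`. -/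
noncomputable def genericQuadratic : Polynomial (MvPolynomial (Fin 3) ℂ) :=
  .C (X 0) + .C (2 * X 1) * .X + .C (X 2) * .X ^ 2

/-- The monomial `x_0^a x_1^b x_2^c`. -/
noncomputable def ternaryMonomial (a b c : ℕ) : MvPolynomial (Fin 3) ℂ :=
  X 0 ^ a * X 1 ^ b * X 2 ^ c

/-- The span of the iterates of `F` on `x_0^d`. -/
noncomputable def iterateSpan (d : ℕ) : Submodule ℂ (MvPolynomial (Fin 3) ℂ) :=
  Submodule.span ℂ (Set.range fun m : ℕ => (fun p => F2 p)^[m] (X 0 ^ d))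

/-- The span of the coefficients of `(x_0 + 2 x_1 t + x_2 t²)^d`. -/
noncomputable def coeffSpan (d : ℕ) : Submodule ℂ (MvPolynomial (Fin 3) ℂ) :=
  Submodule.span ℂ (Set.range (genericQuadratic ^ d).coeff)

section Derivation

variable {R A : Type*} [CommRing R] [CommRing A] [Algebra R A] (D : Derivation R A A)

theorem Derivation.apply_coeff_pow {p p' : Polynomial A} (h : ∀ n, D (p.coeff n) = p'.coeff n)
    (d n : ℕ) : D ((p ^ d).coeff n) = ((d : Polynomial A) * p ^ (d - 1) * p').coeff n := by
  induction d generalizing n with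
  | zero =>
    rw [pow_zero, Polynomial.coeff_one]
    split_ifs <;> simp
  | succ d ih =>
    have key : ((d + 1 : ℕ) : Polynomial A) * p ^ (d + 1 - 1) * p' =
        p ^ d * p' + p * ((d : Polynomial A) * p ^ (d - 1) * p') := by
      rcases d with _ | d
      · simp
      · rw [Nat.add_sub_cancel, Nat.add_sub_cancel]
        push_cast
        ring
    rw [key, pow_succ, Polynomial.coeff_mul, map_sum, Polynomial.coeff_add, mul_comm p,
      Polynomial.coeff_mul, Polynomial.coeff_mul, ← Finset.sum_add_distrib]
    refine Finset.sum_congr rfl fun x _ => ?_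
    rw [D.leibniz, h, ih, smul_eq_mul, smul_eq_mul, mul_comm (p.coeff _)]

theorem Derivation.apply_mem_mul {M N : Submodule R A} (hM : ∀ x ∈ M, D x ∈ M)
    (hN : ∀ x ∈ N, D x ∈ N) : ∀ x ∈ M * N, D x ∈ M * N := by
  intro x hx
  induction hx using Submodule.mul_induction_on' with
  | mem_mul_mem m hm n hn =>
    rw [D.leibniz, smul_eq_mul, smul_eq_mul, mul_comm n]
    exact add_mem (Submodule.mul_mem_mul hm (hN n hn)) (Submodule.mul_mem_mul (hM m hm) hn)
  | add x _ y _ hx hy =>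
    rw [map_add]
    exact add_mem hx hy

theorem Derivation.apply_mem_pow {M : Submodule R A} (hM : ∀ x ∈ M, D x ∈ M) (k : ℕ) :
    ∀ x ∈ M ^ k, D x ∈ M ^ k := by
  induction k with
  | zero =>
    intro x hx
    rw [pow_zero, Submodule.mem_one] at hx
    obtain ⟨r, rfl⟩ := hx
    simp
  | succ k ih =>
    rw [pow_succ]
    exact D.apply_mem_mul ih hM

theorem Derivation.apply_mem_span {s : Set A} {N : Submodule R A} (h : ∀ x ∈ s, D x ∈ N) :
    ∀ x ∈ Submodule.span R s, D x ∈ N := by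
  intro x hx
  exact (Submodule.span_le (p := N.comap D.toLinearMap)).2 h hx

end Derivation

theorem Submodule.mem_of_sum_mem_of_forall_ne {R M ι : Type*} [Ring R] [AddCommGroup M]
    [Module R M] (T : Submodule R M) {s : Finset ι} {f : ι → M} {i : ι} (hi : i ∈ s)
    (hsum : ∑ j ∈ s, f j ∈ T) (h : ∀ j ∈ s, j ≠ i → f j ∈ T) : f i ∈ T := by
  classical
  rw [← Finset.add_sum_erase s f hi] at hsum
  refine (T.add_mem_iff_left (T.sum_mem fun j hj => ?_)).1 hsum
  exact h j (Finset.mem_of_mem_erase hj) (Finset.ne_of_mem_erase hj)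

theorem natCast_mul_pow_mul_derivative (d : ℕ) :
    (d : Polynomial (MvPolynomial (Fin 3) ℂ)) * genericQuadratic ^ (d - 1) *
      Polynomial.derivative genericQuadratic = Polynomial.derivative (genericQuadratic ^ d) := by
  rw [Polynomial.derivative_pow, map_natCast]

theorem F2_coeff_genericQuadratic_pow (d m : ℕ) :
    F2 ((genericQuadratic ^ d).coeff m) =
      ((m : ℂ) + 1) • (genericQuadratic ^ d).coeff (m + 1) := by
  have h : ∀ n, F2 (genericQuadratic.coeff n) =
      (Polynomial.derivative genericQuadratic).coeff n := by
    intro n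
    rw [Polynomial.coeff_derivative]
    have h2 : F2 2 = 0 := F2.map_natCast 2
    rcases n with _ | _ | _ | n <;>
      simp [genericQuadratic, Polynomial.coeff_X, Polynomial.coeff_C, Polynomial.coeff_X_pow, h2,
        mul_assoc]
      <;> simp [F2, mkDerivation_X]
    ring
  rw [F2.apply_coeff_pow h, natCast_mul_pow_mul_derivative, Polynomial.coeff_derivative,
    smul_eq_C_mul, mul_comm]
  simp

theorem E2_coeff_genericQuadratic_pow_eq (d m : ℕ) :
    E2 ((genericQuadratic ^ d).coeff m) =
      ((2 * d : ℂ) • (Polynomial.X * genericQuadratic ^ d) - Polynomial.X *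
        (Polynomial.X * Polynomial.derivative (genericQuadratic ^ d))).coeff m := by
  have h : ∀ n, E2 (genericQuadratic.coeff n) =
      (2 * Polynomial.X * genericQuadratic -
        Polynomial.X * (Polynomial.X * Polynomial.derivative genericQuadratic)).coeff n := by
    intro n
    have h2 : E2 2 = 0 := E2.map_natCast 2
    have key : 2 * Polynomial.X * genericQuadratic -
        Polynomial.X * (Polynomial.X * Polynomial.derivative genericQuadratic) =
        .C (2 * X 0) * .X + .C (2 * X 1) * .X ^ 2 := by
      simp [genericQuadratic, map_ofNat Polynomial.C 2]
      ring
    rw [key]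
    rcases n with _ | _ | _ | n <;>
      simp [genericQuadratic, Polynomial.coeff_X, Polynomial.coeff_C, Polynomial.coeff_X_pow, h2,
        mul_assoc]
      <;> simp [E2, mkDerivation_X]
  rw [E2.apply_coeff_pow h, ← natCast_mul_pow_mul_derivative]
  congr 1
  rw [Algebra.smul_def]
  rcases d with _ | d
  · simp
  · simp only [map_mul, map_natCast, map_ofNat, Nat.add_sub_cancel]
    ring

theorem E2_coeff_genericQuadratic_pow (d m : ℕ) :
    E2 ((genericQuadratic ^ d).coeff (m + 1)) =
      (2 * d - m : ℂ) • (genericQuadratic ^ d).coeff m := by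
  rw [E2_coeff_genericQuadratic_pow_eq, Polynomial.coeff_sub, Polynomial.coeff_smul,
    Polynomial.coeff_X_mul, Polynomial.coeff_X_mul, sub_smul]
  rcases m with _ | m
  · simp
  · rw [Polynomial.coeff_X_mul, Polynomial.coeff_derivative,
      smul_eq_C_mul (a := (↑(m + 1) : ℂ)),
      mul_comm (C _)]
    simp

theorem E2_coeff_zero_genericQuadratic_pow (d : ℕ) :
    E2 ((genericQuadratic ^ d).coeff 0) = 0 := by
  simp [E2_coeff_genericQuadratic_pow_eq]

theorem coeff_genericQuadratic_pow (d m : ℕ) :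
    (genericQuadratic ^ d).coeff m =
      ∑ x ∈ (Finset.range (d + 1) ×ˢ Finset.range (d + 1)).filter
          (fun x => x.2 ≤ x.1 ∧ x.1 + x.2 = m),
        ((d.choose x.1 * x.1.choose x.2 * 2 ^ (x.1 - x.2) : ℕ) : ℂ) •
          ternaryMonomial (d - x.1) (x.1 - x.2) x.2 := by
  have expand : genericQuadratic ^ d =
      ∑ x ∈ (Finset.range (d + 1) ×ˢ Finset.range (d + 1)).filter (fun x => x.2 ≤ x.1),
        Polynomial.monomial (x.1 + x.2)
          (((d.choose x.1 * x.1.choose x.2 * 2 ^ (x.1 - x.2) : ℕ) : ℂ) •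
            ternaryMonomial (d - x.1) (x.1 - x.2) x.2) := by
    have hq : genericQuadratic = .X * (.C (X 2) * .X + .C (2 * X 1)) + .C (X 0) := by
      rw [genericQuadratic]
      ring
    rw [hq, add_pow, Finset.sum_filter, Finset.sum_product]
    refine Finset.sum_congr rfl fun i hi => ?_
    rw [← Finset.sum_filter, mul_pow, add_pow, Finset.mul_sum, Finset.sum_mul, Finset.sum_mul]
    have hs : (Finset.range (d + 1)).filter (fun c => c ≤ i) = Finset.range (i + 1) := by
      ext c
      simp only [Finset.mem_filter, Finset.mem_range] at hi ⊢
      omega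
    rw [hs]
    refine Finset.sum_congr rfl fun c _ => ?_
    rw [← Polynomial.C_mul_X_pow_eq_monomial, Algebra.smul_def, map_natCast, ternaryMonomial]
    simp only [Polynomial.C_mul, Polynomial.C_pow, Nat.cast_mul, Nat.cast_pow, Nat.cast_ofNat,
      Polynomial.C_ofNat, map_natCast]
    ring
  rw [expand, Polynomial.finsetSum_coeff, ← Finset.filter_filter,
    Finset.sum_filter (p := fun x : ℕ × ℕ => x.1 + x.2 = m)]
  exact Finset.sum_congr rfl fun x _ => Polynomial.coeff_monomial

theorem coeffSpan_le_iterateSpan (d : ℕ) : coeffSpan d ≤ iterateSpan d := by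
  have hF : ∀ x ∈ iterateSpan d, F2 x ∈ iterateSpan d := by
    refine F2.apply_mem_span ?_
    rintro _ ⟨m, rfl⟩
    refine Submodule.subset_span ⟨m + 1, ?_⟩
    simp only [Function.iterate_succ_apply']
  refine Submodule.span_le.2 ?_
  rintro _ ⟨m, rfl⟩
  induction m with
  | zero =>
    refine Submodule.subset_span ⟨0, ?_⟩
    simp [Polynomial.coeff_zero_eq_eval_zero, genericQuadratic]
  | succ m ih =>
    have := hF _ ih
    rw [F2_coeff_genericQuadratic_pow] at this
    exact ((iterateSpan d).smul_mem_iff (Nat.cast_add_one_ne_zero m)).1 this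

theorem F2_mem_coeffSpan (d : ℕ) : ∀ x ∈ coeffSpan d, F2 x ∈ coeffSpan d := by
  refine F2.apply_mem_span ?_
  rintro _ ⟨m, rfl⟩
  rw [F2_coeff_genericQuadratic_pow]
  exact Submodule.smul_mem _ _ (Submodule.subset_span ⟨_, rfl⟩)

theorem E2_mem_coeffSpan (d : ℕ) : ∀ x ∈ coeffSpan d, E2 x ∈ coeffSpan d := by
  refine E2.apply_mem_span ?_
  rintro _ ⟨_ | m, rfl⟩
  · rw [E2_coeff_zero_genericQuadratic_pow]
    exact zero_mem _
  · rw [E2_coeff_genericQuadratic_pow]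
    exact Submodule.smul_mem _ _ (Submodule.subset_span ⟨_, rfl⟩)

theorem E2_ternaryMonomial (a b c : ℕ) :
    E2 (ternaryMonomial a (b + 1) c) = ((b : ℂ) + 1) • ternaryMonomial (a + 1) b c +
      (2 * c : ℂ) • ternaryMonomial a (b + 2) (c - 1) := by
  simp only [ternaryMonomial, Derivation.leibniz, Derivation.leibniz_pow, smul_eq_C_mul]
  simp [E2, mkDerivation_X, map_ofNat C 2]
  ring

theorem F2_ternaryMonomial (a b c : ℕ) :
    F2 (ternaryMonomial a (b + 1) c) = ((b : ℂ) + 1) • ternaryMonomial a b (c + 1) +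
      (2 * a : ℂ) • ternaryMonomial (a - 1) (b + 2) c := by
  simp only [ternaryMonomial, Derivation.leibniz, Derivation.leibniz_pow, smul_eq_C_mul]
  simp [F2, mkDerivation_X, map_ofNat C 2]
  ring

section Stable

variable {T : Submodule ℂ (MvPolynomial (Fin 3) ℂ)} {N : ℕ}

theorem ternaryMonomial_mem_of_E2_stable (hE : ∀ x ∈ T, E2 x ∈ T)
    (h0 : ∀ a b, 2 * a + b = N → ternaryMonomial a b a ∈ T) (r c b : ℕ)
    (h : 2 * c + r + b = N) : ternaryMonomial (c + r) b c ∈ T := by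
  induction r generalizing c b with
  | zero => exact h0 c b (by omega)
  | succ r ihr =>
    induction c generalizing b with
    | zero =>
      have := hE _ (ihr 0 (b + 1) (by omega))
      rw [E2_ternaryMonomial, Nat.cast_zero, mul_zero, zero_smul, add_zero] at this
      exact (T.smul_mem_iff (Nat.cast_add_one_ne_zero b)).1 this
    | succ c ihc =>
      have := hE _ (ihr (c + 1) (b + 1) (by omega))
      rw [E2_ternaryMonomial] at this
      have h2 := ihc (b + 2) (by omega)
      rw [show c + (r + 1) = c + 1 + r by omega] at h2
      exact (T.smul_mem_iff (Nat.cast_add_one_ne_zero b)).1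
        ((T.add_mem_iff_left (T.smul_mem _ h2)).1 this)

theorem ternaryMonomial_mem_of_F2_stable (hF : ∀ x ∈ T, F2 x ∈ T)
    (h0 : ∀ a b, 2 * a + b = N → ternaryMonomial a b a ∈ T) (r a b : ℕ)
    (h : 2 * a + r + b = N) : ternaryMonomial a b (a + r) ∈ T := by
  induction r generalizing a b with
  | zero => exact h0 a b (by omega)
  | succ r ihr =>
    induction a generalizing b with
    | zero =>
      have := hF _ (ihr 0 (b + 1) (by omega))
      rw [F2_ternaryMonomial, Nat.cast_zero, mul_zero, zero_smul, add_zero] at this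
      exact (T.smul_mem_iff (Nat.cast_add_one_ne_zero b)).1 this
    | succ a iha =>
      have := hF _ (ihr (a + 1) (b + 1) (by omega))
      rw [F2_ternaryMonomial] at this
      have h2 := iha (b + 2) (by omega)
      rw [show a + (r + 1) = a + 1 + r by omega] at h2
      exact (T.smul_mem_iff (Nat.cast_add_one_ne_zero b)).1
        ((T.add_mem_iff_left (T.smul_mem _ h2)).1 this)

theorem ternaryMonomial_mem_of_stable (hE : ∀ x ∈ T, E2 x ∈ T) (hF : ∀ x ∈ T, F2 x ∈ T)
    (h0 : ∀ a b, 2 * a + b = N → ternaryMonomial a b a ∈ T) (a b c : ℕ)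
    (h : a + b + c = N) : ternaryMonomial a b c ∈ T := by
  rcases le_total c a with hca | hac
  · obtain ⟨r, rfl⟩ := Nat.exists_eq_add_of_le hca
    exact ternaryMonomial_mem_of_E2_stable hE h0 r c b (by omega)
  · obtain ⟨r, rfl⟩ := Nat.exists_eq_add_of_le hac
    exact ternaryMonomial_mem_of_F2_stable hF h0 r a b (by omega)

/-- Downward induction on the exponent of `x_0 x_2` for the monomials of weight zero. -/
theorem ternaryMonomial_mem_of_forall_lt
    (h : ∀ a b, 2 * a + b = N →
      (∀ a' b', a < a' → 2 * a' + b' = N → ternaryMonomial a' b' a' ∈ T) →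
      ternaryMonomial a b a ∈ T) (a b : ℕ) (hab : 2 * a + b = N) :
    ternaryMonomial a b a ∈ T := by
  induction b using Nat.strong_induction_on generalizing a with
  | _ b ih => exact h a b hab fun a' b' ha h' => ih b' (by omega) a' h'

end Stable

theorem ternaryMonomial_mul (a b c a' b' c' : ℕ) :
    ternaryMonomial a b c * ternaryMonomial a' b' c' =
      ternaryMonomial (a + a') (b + b') (c + c') := by
  simp only [ternaryMonomial]
  ring

theorem coeff_mem_coeffSpan (d m : ℕ) : (genericQuadratic ^ d).coeff m ∈ coeffSpan d :=
  Submodule.subset_span ⟨m, rfl⟩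

theorem choose_mul_choose_mul_two_pow_ne_zero {d i c : ℕ} (hi : i ≤ d) (hc : c ≤ i) :
    ((d.choose i * i.choose c * 2 ^ (i - c) : ℕ) : ℂ) ≠ 0 :=
  Nat.cast_ne_zero.2 (mul_ne_zero (mul_ne_zero (Nat.choose_pos hi).ne' (Nat.choose_pos hc).ne')
    (pow_ne_zero _ two_ne_zero))

theorem ternaryMonomial_mem_coeffSpan_sq (d a b c : ℕ) (h : a + b + c = 2 * d) :
    ternaryMonomial a b c ∈ coeffSpan d ^ 2 := by
  refine ternaryMonomial_mem_of_stable (E2.apply_mem_pow (E2_mem_coeffSpan d) 2)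
    (F2.apply_mem_pow (F2_mem_coeffSpan d) 2) (ternaryMonomial_mem_of_forall_lt ?_) a b c h
  clear! a b c
  intro i b hi ih
  have hprod := Submodule.mul_mem_mul
    (coeff_mem_coeffSpan d (d - i)) (coeff_mem_coeffSpan d (d + i))
  rw [← sq, coeff_genericQuadratic_pow, coeff_genericQuadratic_pow, Finset.sum_mul_sum,
    ← Finset.sum_product'] at hprod
  have := Submodule.mem_of_sum_mem_of_forall_ne (i := ((d - i, 0), (d, i))) _ ?_ hprod ?_
  · simp only [smul_mul_smul_comm, ternaryMonomial_mul] at this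
    rw [Submodule.smul_mem_iff _ (mul_ne_zero
      (choose_mul_choose_mul_two_pow_ne_zero (by omega) (by omega))
      (choose_mul_choose_mul_two_pow_ne_zero (by omega) (by omega)))] at this
    convert this using 2 <;> omega
  · simp only [Finset.mem_product, Finset.mem_filter, Finset.mem_range, and_true]
    omega
  · rintro ⟨⟨i₁, c₁⟩, i₂, c₂⟩ hx hne
    simp only [Finset.mem_product, Finset.mem_filter, Finset.mem_range, ne_eq,
      Prod.mk.injEq] at hx hne
    simp only [smul_mul_smul_comm, ternaryMonomial_mul]
    refine Submodule.smul_mem _ _ ?_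
    rw [show d - i₁ + (d - i₂) = c₁ + c₂ by omega]
    exact ih _ _ (by omega) (by omega)

theorem ternaryMonomial_mem_coeffSpan_pow_succ {d k : ℕ} (hk : 1 ≤ k)
    (hT : ∀ a b c, a + b + c = k * d → ternaryMonomial a b c ∈ coeffSpan d ^ k)
    (a b c : ℕ) (h : a + b + c = (k + 1) * d) :
    ternaryMonomial a b c ∈ coeffSpan d ^ (k + 1) := by
  refine ternaryMonomial_mem_of_stable (E2.apply_mem_pow (E2_mem_coeffSpan d) _)
    (F2.apply_mem_pow (F2_mem_coeffSpan d) _) (ternaryMonomial_mem_of_forall_lt ?_) a b c h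
  clear! a b c
  intro i b hi ih
  have hdk : d ≤ k * d := Nat.le_mul_of_pos_left d hk
  rw [add_mul, one_mul] at hi ih
  obtain ⟨j, hj⟩ : ∃ j, j = min i d := ⟨_, rfl⟩
  have hprod := Submodule.mul_mem_mul
    (hT (i - j) (b - (d - j)) i (by omega)) (coeff_mem_coeffSpan d (d - j))
  rw [← pow_succ, coeff_genericQuadratic_pow, Finset.mul_sum] at hprod
  have := Submodule.mem_of_sum_mem_of_forall_ne (i := (d - j, 0)) _ ?_ hprod ?_
  · simp only [mul_smul_comm, ternaryMonomial_mul] at this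
    rw [Submodule.smul_mem_iff _
      (choose_mul_choose_mul_two_pow_ne_zero (by omega) (by omega))] at this
    convert this using 2 <;> omega
  · simp only [Finset.mem_product, Finset.mem_filter, Finset.mem_range]
    omega
  · rintro ⟨i₁, c₁⟩ hx hne
    simp only [Finset.mem_product, Finset.mem_filter, Finset.mem_range, ne_eq,
      Prod.mk.injEq] at hx hne
    simp only [mul_smul_comm, ternaryMonomial_mul]
    refine Submodule.smul_mem _ _ ?_
    rw [show i - j + (d - i₁) = i + c₁ by omega]
    exact ih _ _ (by omega) (by omega)

theorem ternaryMonomial_mem_coeffSpan_pow {d k : ℕ} (hk : 2 ≤ k) (a b c : ℕ)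
    (h : a + b + c = k * d) : ternaryMonomial a b c ∈ coeffSpan d ^ k := by
  induction k, hk using Nat.le_induction generalizing a b c with
  | base => exact ternaryMonomial_mem_coeffSpan_sq d a b c h
  | succ k hk ih => exact ternaryMonomial_mem_coeffSpan_pow_succ (by omega) ih a b c h

theorem homogeneousSubmodule_le_coeffSpan_pow {d k : ℕ} (hk : 2 ≤ k) :
    homogeneousSubmodule (Fin 3) ℂ (k * d) ≤ coeffSpan d ^ k := by
  intro p hp
  rw [p.as_sum]
  refine Submodule.sum_mem _ fun s hs => ?_
  have hs' := (mem_homogeneousSubmodule _ _).1 hp (mem_support_iff.1 hs)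
  have hmon : monomial s (coeff s p) = coeff s p • ternaryMonomial (s 0) (s 1) (s 2) := by
    rw [monomial_eq, Finsupp.prod_fintype _ _ (by simp), Fin.prod_univ_three, smul_eq_C_mul,
      ternaryMonomial]
  rw [hmon]
  refine Submodule.smul_mem _ _ (ternaryMonomial_mem_coeffSpan_pow hk _ _ _ ?_)
  rw [← hs', Finsupp.weight_apply, Finsupp.sum_fintype _ _ (by simp), Fin.sum_univ_three]
  simp

/-- For `k ≥ 2`, every homogeneous polynomial of degree `k·d` in `ℂ[x_0,x_1,x_2]` is a linear
combination of products `w_1⋯w_k` with each `w_j` in `W_d = span{F^m(x_0^d) : m ≥ 0}`. -/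
theorem veronese_generated_by_Wd (d : ℕ) (hd : 1 ≤ d) (k : ℕ) (hk : 2 ≤ k)
    (p : MvPolynomial (Fin 3) ℂ) (hp : p ∈ homogeneousSubmodule (Fin 3) ℂ (k * d)) :
    p ∈ Submodule.span ℂ
        {q : MvPolynomial (Fin 3) ℂ | ∃ w : Fin k → MvPolynomial (Fin 3) ℂ,
          (∀ j, w j ∈ Submodule.span ℂ
            (Set.range fun m : ℕ => (fun p => F2 p)^[m] (X 0 ^ d))) ∧
          q = ∏ j, w j} := by
  have hmem : p ∈ iterateSpan d ^ k :=
    pow_le_pow_left' (coeffSpan_le_iterateSpan d) k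
      (homogeneousSubmodule_le_coeffSpan_pow hk hp)
  rw [Submodule.pow_eq_span_pow_set] at hmem
  refine Submodule.span_mono ?_ hmem
  intro q hq
  obtain ⟨f, rfl⟩ := Set.mem_pow.1 hq
  exact ⟨fun j => f j, fun j => (f j).2, List.prod_ofFn⟩
end

section
/- Let d ≥ 1 and let φ : ℂ[y_0,…,y_{2d}] → ℂ[x_0,x_1,x_2] be the ℂ-algebra homomorphism determined by φ(y_m) = F^m(x_0^d) for 0 ≤ m ≤ 2d. Then the kernel of φ is generated, as an ideal, by its homogeneous elements of degree at most 3 (where each variable y_m is given degree 1). -/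
open MvPolynomial

/-- The span of the monomials `x_0^a x_1^b x_2^c` whose exponents satisfy `P`. -/
noncomputable def monomialSpan (P : ℕ → ℕ → ℕ → Prop) : Submodule ℂ (MvPolynomial (Fin 3) ℂ) :=
  Submodule.span ℂ {p | ∃ a b c, P a b c ∧ p = X 0 ^ a * X 1 ^ b * X 2 ^ c}

lemma monomialSpan_le {P : ℕ → ℕ → ℕ → Prop} {N : Submodule ℂ (MvPolynomial (Fin 3) ℂ)}
    (h : ∀ a b c, P a b c → X 0 ^ a * X 1 ^ b * X 2 ^ c ∈ N) : monomialSpan P ≤ N := by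
  refine Submodule.span_le.2 ?_
  rintro _ ⟨a, b, c, hP, rfl⟩
  exact h a b c hP

lemma mem_monomialSpan {P : ℕ → ℕ → ℕ → Prop} {a b c : ℕ} (h : P a b c) :
    X 0 ^ a * X 1 ^ b * X 2 ^ c ∈ monomialSpan P :=
  Submodule.subset_span ⟨a, b, c, h, rfl⟩

lemma monomialSpan_mono {P Q : ℕ → ℕ → ℕ → Prop} (h : ∀ a b c, P a b c → Q a b c) :
    monomialSpan P ≤ monomialSpan Q :=
  monomialSpan_le fun a b c hP => mem_monomialSpan (h a b c hP)

lemma mul_mem_monomialSpan {P Q R : ℕ → ℕ → ℕ → Prop}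
    (h : ∀ a b c a' b' c', P a b c → Q a' b' c' → R (a + a') (b + b') (c + c'))
    {f g : MvPolynomial (Fin 3) ℂ} (hf : f ∈ monomialSpan P) (hg : g ∈ monomialSpan Q) :
    f * g ∈ monomialSpan R := by
  have hmul : monomialSpan P * monomialSpan Q ≤ monomialSpan R := by
    rw [monomialSpan, monomialSpan, Submodule.span_mul_span]
    refine Submodule.span_le.2 ?_
    rintro _ ⟨_, ⟨a, b, c, hP, rfl⟩, _, ⟨a', b', c', hQ, rfl⟩, rfl⟩
    have e : X 0 ^ a * X 1 ^ b * X 2 ^ c * (X 0 ^ a' * X 1 ^ b' * X 2 ^ c')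
        = (X 0 ^ (a + a') * X 1 ^ (b + b') * X 2 ^ (c + c') : MvPolynomial (Fin 3) ℂ) := by ring
    simp only [SetLike.mem_coe, e]
    exact mem_monomialSpan (h a b c a' b' c' hP hQ)
  exact hmul (Submodule.mul_mem_mul hf hg)

lemma monomial_eq_X_pow (s : Fin 3 →₀ ℕ) (r : ℂ) :
    monomial s r = r • (X 0 ^ s 0 * X 1 ^ s 1 * X 2 ^ s 2) := by
  rw [monomial_eq, smul_eq_C_mul, Finsupp.prod_fintype _ _ (by simp), Fin.prod_univ_three]

lemma homogeneousSubmodule_eq_monomialSpan (n : ℕ) :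
    homogeneousSubmodule (Fin 3) ℂ n = monomialSpan fun a b c => a + b + c = n := by
  apply le_antisymm
  · intro f hf
    rw [f.as_sum]
    refine Submodule.sum_mem _ fun s hs => ?_
    rw [monomial_eq_X_pow]
    refine Submodule.smul_mem _ _ (mem_monomialSpan ?_)
    have := hf.degree_eq_sum_deg_support hs
    rw [this, ← Fin.sum_univ_three s, ← Finsupp.degree_eq_sum]; rfl
  · refine monomialSpan_le fun a b c h => ?_
    rw [mem_homogeneousSubmodule, ← h]
    exact ((isHomogeneous_X_pow 0 a).mul (isHomogeneous_X_pow 1 b)).mul (isHomogeneous_X_pow 2 c)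

lemma homogeneousComponent_mul_of_isHomogeneous {σ : Type*} {p : MvPolynomial σ ℂ} {m : ℕ}
    (hp : p.IsHomogeneous m) (q : MvPolynomial σ ℂ) (n : ℕ) :
    homogeneousComponent (m + n) (p * q) = p * homogeneousComponent n q := by
  let _ := gradedAlgebra (σ := σ) (R := ℂ)
  rw [← decomposition.decompose'_apply, ← decomposition.decompose'_apply]
  exact DirectSum.coe_decompose_mul_add_of_left_mem (homogeneousSubmodule σ ℂ)
    (i := m) (j := n) (b := q) hp

lemma F2_X_zero : F2 (X 0) = 2 * X 1 := by simp [F2, mkDerivation_X]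
lemma F2_X_one : F2 (X 1) = X 2 := by simp [F2, mkDerivation_X]
lemma F2_X_two : F2 (X 2) = 0 := by simp [F2, mkDerivation_X]

lemma F2_apply (f : MvPolynomial (Fin 3) ℂ) :
    F2 f = 2 * X 1 * pderiv 0 f + X 2 * pderiv 1 f := by
  have h : F2 = (2 * X 1 : MvPolynomial (Fin 3) ℂ) • pderiv 0
      + (X 2 : MvPolynomial (Fin 3) ℂ) • pderiv 1 := by
    refine derivation_ext fun i => ?_
    fin_cases i <;> simp [F2_X_zero, F2_X_one, F2_X_two, pderiv_X]
  rw [h]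
  simp

lemma F2_monomial (a b c : ℕ) :
    F2 (X 0 ^ a * X 1 ^ b * X 2 ^ c) =
      (2 * a : ℂ) • (X 0 ^ (a - 1) * X 1 ^ (b + 1) * X 2 ^ c)
        + (b : ℂ) • (X 0 ^ a * X 1 ^ (b - 1) * X 2 ^ (c + 1)) := by
  simp only [Derivation.leibniz, Derivation.leibniz_pow, F2_X_zero, F2_X_one, F2_X_two,
    smul_eq_mul, smul_eq_C_mul, nsmul_eq_mul, map_mul, map_natCast, map_ofNat]
  ring

lemma pderiv_comm {σ : Type*} (i j : σ) (f : MvPolynomial σ ℂ) :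
    pderiv i (pderiv j f) = pderiv j (pderiv i f) := by
  classical
  have h : ⁅pderiv (R := ℂ) (σ := σ) i, pderiv (R := ℂ) (σ := σ) j⁆ = 0 := by
    refine derivation_ext fun k => ?_
    simp [Derivation.commutator_apply, pderiv_X, Pi.single_apply, apply_ite]
  have h' := DFunLike.congr_fun h f
  rwa [Derivation.commutator_apply, Derivation.zero_apply, sub_eq_zero] at h'

lemma pderiv_zero_F2 (f : MvPolynomial (Fin 3) ℂ) : pderiv 0 (F2 f) = F2 (pderiv 0 f) := by
  simp only [F2_apply, map_add, pderiv_mul]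
  have : pderiv (R := ℂ) (0 : Fin 3) 2 = 0 := pderiv_C (a := 2)
  simp [pderiv_X, this, pderiv_comm (1 : Fin 3) 0]

lemma pderiv_one_F2 (f : MvPolynomial (Fin 3) ℂ) :
    pderiv 1 (F2 f) = F2 (pderiv 1 f) + 2 * pderiv 0 f := by
  simp only [F2_apply, map_add, pderiv_mul]
  have : pderiv (R := ℂ) (1 : Fin 3) 2 = 0 := pderiv_C (a := 2)
  simp [pderiv_X, this, pderiv_comm (1 : Fin 3) 0]
  ring

lemma pderiv_two_F2 (f : MvPolynomial (Fin 3) ℂ) :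
    pderiv 2 (F2 f) = F2 (pderiv 2 f) + pderiv 1 f := by
  simp only [F2_apply, map_add, pderiv_mul]
  have : pderiv (R := ℂ) (2 : Fin 3) 2 = 0 := pderiv_C (a := 2)
  simp [pderiv_X, this, pderiv_comm (2 : Fin 3) 0, pderiv_comm (2 : Fin 3) 1]
  ring

/-- The `sl₂`-invariant second order operator `∂₁² - 4 ∂₀ ∂₂`. -/
noncomputable def laplace (f : MvPolynomial (Fin 3) ℂ) : MvPolynomial (Fin 3) ℂ :=
  pderiv 1 (pderiv 1 f) - 4 * pderiv 0 (pderiv 2 f)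

lemma map_iterate_F2_comm {T : MvPolynomial (Fin 3) ℂ → MvPolynomial (Fin 3) ℂ}
    (h : ∀ f, T (F2 f) = F2 (T f)) (m : ℕ) (f : MvPolynomial (Fin 3) ℂ) :
    T (F2^[m] f) = F2^[m] (T f) :=
  (Function.Commute.iterate_right (f := T) (g := F2) h m) f

lemma laplace_F2 (f : MvPolynomial (Fin 3) ℂ) : laplace (F2 f) = F2 (laplace f) := by
  have h4 : ∀ g, F2 (4 * g) = 4 * F2 g := fun g => by
    rw [← map_ofNat C, ← smul_eq_C_mul, Derivation.map_smul, smul_eq_C_mul]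
  have h2 : ∀ g : MvPolynomial (Fin 3) ℂ, pderiv 1 (2 * g) = 2 * pderiv 1 g := fun g => by
    rw [← map_ofNat C, pderiv_C_mul]
  simp only [laplace, pderiv_one_F2, pderiv_two_F2, pderiv_zero_F2, map_add, map_sub, h4, h2]
  rw [pderiv_comm (1 : Fin 3) 0]
  ring

lemma laplace_smul (c : ℂ) (f : MvPolynomial (Fin 3) ℂ) : laplace (c • f) = c • laplace f := by
  simp only [laplace, Derivation.map_smul, smul_sub, mul_smul_comm]

lemma F2_iterate_zero (m : ℕ) : F2^[m] 0 = 0 :=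
  Function.iterate_fixed (map_zero F2) m

lemma laplace_F2_iterate_X_pow (m a : ℕ) : laplace (F2^[m] (X 0 ^ a)) = 0 := by
  rw [map_iterate_F2_comm laplace_F2]
  have : laplace (X 0 ^ a) = 0 := by simp [laplace, pderiv_X]
  rw [this, F2_iterate_zero]

lemma F2_iterate_smul (m : ℕ) (c : ℂ) (f : MvPolynomial (Fin 3) ℂ) :
    F2^[m] (c • f) = c • F2^[m] f := by
  induction m generalizing f with
  | zero => rfl
  | succ m ih => rw [Function.iterate_succ_apply, Function.iterate_succ_apply,
      Derivation.map_smul, ih]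

lemma pderiv_one_F2_iterate (m a : ℕ) :
    pderiv 1 (F2^[m + 1] (X 0 ^ (a + 1))) =
      (2 * (m + 1) * (a + 1) : ℂ) • F2^[m] (X 0 ^ a) := by
  have h0 : pderiv 0 (X 0 ^ (a + 1) : MvPolynomial (Fin 3) ℂ) = (a + 1 : ℂ) • X 0 ^ a := by
    simp [smul_eq_C_mul]
  have hc : ∀ m, (2 : MvPolynomial (Fin 3) ℂ) * pderiv 0 (F2^[m] (X 0 ^ (a + 1)))
      = (2 * (a + 1) : ℂ) • F2^[m] (X 0 ^ a) := fun m => by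
    rw [map_iterate_F2_comm pderiv_zero_F2, h0, F2_iterate_smul, smul_eq_C_mul, smul_eq_C_mul]
    simp only [map_mul, map_ofNat]
    ring
  induction m with
  | zero =>
    rw [Function.iterate_succ_apply', pderiv_one_F2, hc]
    simp [pderiv_X]
  | succ m ih =>
    rw [Function.iterate_succ_apply', pderiv_one_F2, hc, ih, Derivation.map_smul,
      ← Function.iterate_succ_apply' F2 m, ← add_smul]
    congr 1
    push_cast
    ring

lemma pderiv_two_F2_iterate (m a : ℕ) :
    pderiv 2 (F2^[m + 2] (X 0 ^ (a + 1))) =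
      ((m + 2) * (m + 1) * (a + 1) : ℂ) • F2^[m] (X 0 ^ a) := by
  induction m with
  | zero =>
    rw [Function.iterate_succ_apply', pderiv_two_F2, pderiv_one_F2_iterate,
      Function.iterate_succ_apply', pderiv_two_F2]
    simp [pderiv_X]
  | succ m ih =>
    rw [Function.iterate_succ_apply', pderiv_two_F2, pderiv_one_F2_iterate, ih, Derivation.map_smul,
      ← Function.iterate_succ_apply' F2 m, ← add_smul]
    congr 1
    push_cast
    ring

lemma laplace_X_pow_mul (a : ℕ) (g : MvPolynomial (Fin 3) ℂ) (hg : laplace g = 0) :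
    laplace (X 0 ^ (a + 1) * g) = (-4 * (a + 1) : ℂ) • (X 0 ^ a * pderiv 2 g) := by
  have e : laplace (X 0 ^ (a + 1) * g) = X 0 ^ (a + 1) * laplace g
      + (-4 * (a + 1) : ℂ) • (X 0 ^ a * pderiv 2 g) := by
    simp [laplace, pderiv_X, smul_eq_C_mul, map_ofNat C]
    ring
  rw [e, hg, mul_zero, zero_add]

lemma laplace_iterate_X_pow_mul (k a b : ℕ) :
    ∃ c : ℂ, c ≠ 0 ∧
      laplace^[k] (X 0 ^ (a + k) * F2^[2 * k] (X 0 ^ (b + k))) = c • (X 0 ^ (a + b)) := by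
  induction k with
  | zero => exact ⟨1, one_ne_zero, by simp [pow_add]⟩
  | succ k ih =>
    obtain ⟨c, hc, h⟩ := ih
    have hs : ∀ (r : ℂ) f, laplace^[k] (r • f) = r • laplace^[k] f := fun r f =>
      (Function.Commute.iterate_left (f := laplace) (g := fun f => r • f) (laplace_smul r) k) f
    have e : laplace (X 0 ^ (a + (k + 1)) * F2^[2 * (k + 1)] (X 0 ^ (b + (k + 1)))) =
        ((-4 * ((a + k : ℕ) + 1)) * (((2 * k : ℕ) + 2) * ((2 * k : ℕ) + 1) * ((b + k : ℕ) + 1)) : ℂ)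
          • (X 0 ^ (a + k) * F2^[2 * k] (X 0 ^ (b + k))) := by
      rw [← add_assoc, ← add_assoc, laplace_X_pow_mul _ _ (laplace_F2_iterate_X_pow _ _),
        show 2 * (k + 1) = 2 * k + 2 by ring, pderiv_two_F2_iterate, mul_smul_comm, smul_smul]
    rw [Function.iterate_succ_apply, e, hs, h, smul_smul]
    refine ⟨_, mul_ne_zero (mul_ne_zero (mul_ne_zero (by norm_num) ?_)
      (mul_ne_zero (mul_ne_zero ?_ ?_) ?_)) hc, rfl⟩ <;> norm_cast

lemma X_pow_mul_F2_iterate_ne_F2 {d k : ℕ} (hk : k ≤ d) (f : MvPolynomial (Fin 3) ℂ) :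
    X 0 ^ d * F2^[2 * k] (X 0 ^ d) ≠ F2 f := by
  intro h
  obtain ⟨j, rfl⟩ := Nat.exists_eq_add_of_le' hk
  obtain ⟨c, hc, hL⟩ := laplace_iterate_X_pow_mul k j j
  rw [h, (Function.Commute.iterate_left (f := laplace) (g := F2) laplace_F2 k) f] at hL
  have := congrArg (aeval ![(1 : ℂ), 0, 0]) hL
  simp [F2_apply] at this
  exact hc this.symm

/-- The forms of degree `n` all of whose monomials `x_0^a x_1^b x_2^c` satisfy `b + 2 c = w`. -/
noncomputable def weightSpan (n w : ℕ) : Submodule ℂ (MvPolynomial (Fin 3) ℂ) :=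
  monomialSpan fun a b c => a + b + c = n ∧ b + 2 * c = w

lemma F2_mem_weightSpan {n w : ℕ} {f : MvPolynomial (Fin 3) ℂ} (hf : f ∈ weightSpan n w) :
    F2 f ∈ weightSpan n (w + 1) := by
  suffices h : weightSpan n w ≤ (weightSpan n (w + 1)).comap (F2 : _ →ₗ[ℂ] _) from h hf
  refine monomialSpan_le fun a b c h => ?_
  rw [Submodule.mem_comap, Derivation.coeFn_coe, F2_monomial]
  refine Submodule.add_mem _ ?_ ?_
  · rcases a with _ | a
    · simp
    · exact Submodule.smul_mem _ _ (mem_monomialSpan (by omega))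
  · rcases b with _ | b
    · simp
    · exact Submodule.smul_mem _ _ (mem_monomialSpan (by omega))

lemma F2_iterate_mem_weightSpan {n w : ℕ} {f : MvPolynomial (Fin 3) ℂ}
    (hf : f ∈ weightSpan n w) (m : ℕ) : F2^[m] f ∈ weightSpan n (w + m) := by
  induction m with
  | zero => exact hf
  | succ m ih =>
    rw [Function.iterate_succ_apply']
    exact F2_mem_weightSpan ih

lemma X_pow_mem_weightSpan (d : ℕ) : X 0 ^ d ∈ weightSpan d 0 := by
  have := mem_monomialSpan (P := fun a b c => a + b + c = d ∧ b + 2 * c = 0)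
    (a := d) (b := 0) (c := 0) (by omega)
  simpa [weightSpan] using this

lemma F2_iterate_X_pow_mem_weightSpan (d m : ℕ) : F2^[m] (X 0 ^ d) ∈ weightSpan d m := by
  simpa using F2_iterate_mem_weightSpan (X_pow_mem_weightSpan d) m

lemma weightSpan_eq_bot {n w : ℕ} (h : 2 * n < w) : weightSpan n w = ⊥ :=
  eq_bot_iff.2 (monomialSpan_le fun a b c _ => by omega)

lemma weightSpan_le_homogeneousSubmodule (n w : ℕ) :
    weightSpan n w ≤ homogeneousSubmodule (Fin 3) ℂ n := by
  rw [homogeneousSubmodule_eq_monomialSpan]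
  exact monomialSpan_mono fun a b c h => h.1

lemma isHomogeneous_F2_iterate_X_pow (d m : ℕ) :
    (F2^[m] (X 0 ^ d)).IsHomogeneous d :=
  weightSpan_le_homogeneousSubmodule d m (F2_iterate_X_pow_mem_weightSpan d m)

/-- The image under `F` of the forms of degree `n`. -/
noncomputable def imageF (n : ℕ) : Submodule ℂ (MvPolynomial (Fin 3) ℂ) :=
  (homogeneousSubmodule (Fin 3) ℂ n).map (F2 : _ →ₗ[ℂ] _)

lemma F2_monomial_mem_imageF {n a b c : ℕ} (h : a + b + c = n) :
    F2 (X 0 ^ a * X 1 ^ b * X 2 ^ c) ∈ imageF n := by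
  refine Submodule.mem_map_of_mem ?_
  rw [homogeneousSubmodule_eq_monomialSpan]
  exact mem_monomialSpan h

lemma monomial_succ_mem_iff {n : ℕ} {N : Submodule ℂ (MvPolynomial (Fin 3) ℂ)} (hN : imageF n ≤ N)
    {a b c : ℕ} (h : a + b + c + 2 = n) :
    X 0 ^ a * X 1 ^ (b + 2) * X 2 ^ c ∈ N ↔ X 0 ^ (a + 1) * X 1 ^ b * X 2 ^ (c + 1) ∈ N := by
  have hF := hN (F2_monomial_mem_imageF (n := n) (a := a + 1) (b := b + 1) (c := c) (by omega))
  rw [F2_monomial] at hF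
  have ha : (2 * (a + 1 : ℕ) : ℂ) ≠ 0 := by norm_cast
  have hb : ((b + 1 : ℕ) : ℂ) ≠ 0 := by norm_cast
  rw [← N.smul_mem_iff ha, ← N.smul_mem_iff hb (x := X 0 ^ (a + 1) * X 1 ^ b * X 2 ^ (c + 1))]
  exact ⟨fun h1 => (N.add_mem_iff_right h1).1 hF, fun h1 => (N.add_mem_iff_left h1).1 hF⟩

lemma monomial_odd_mem_imageF {n a e c : ℕ} (h : a + (2 * e + 1) + c = n) :
    X 0 ^ a * X 1 ^ (2 * e + 1) * X 2 ^ c ∈ imageF n := by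
  induction e generalizing a c with
  | zero =>
    have hF := F2_monomial_mem_imageF (n := n) (a := a + 1) (b := 0) (c := c) (by omega)
    have ha : (2 * (a + 1 : ℕ) : ℂ) ≠ 0 := by norm_cast
    rw [F2_monomial, Nat.cast_zero, zero_smul, add_zero, Submodule.smul_mem_iff _ ha] at hF
    exact hF
  | succ e ih =>
    exact (monomial_succ_mem_iff le_rfl (b := 2 * e + 1) (by omega)).2 (ih (by omega))

lemma monomial_mem_imageF_of_lt {n a b c : ℕ} (hac : a < c) (h : a + b + c = n) :
    X 0 ^ a * X 1 ^ b * X 2 ^ c ∈ imageF n := by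
  induction a generalizing b c with
  | zero =>
    obtain ⟨c, rfl⟩ := Nat.exists_eq_add_of_lt hac
    have hF := F2_monomial_mem_imageF (n := n) (a := 0) (b := b + 1) (c := c) (by omega)
    have hb : ((b + 1 : ℕ) : ℂ) ≠ 0 := by norm_cast
    rw [F2_monomial, Nat.cast_zero, mul_zero, zero_smul, zero_add,
      Submodule.smul_mem_iff _ hb] at hF
    simpa using hF
  | succ a ih =>
    obtain ⟨c, rfl⟩ := Nat.exists_eq_add_of_lt (Nat.zero_lt_of_lt hac)
    rw [zero_add]
    exact (monomial_succ_mem_iff le_rfl (by omega)).1 (ih (by omega) (by omega))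

lemma monomial_even_mem_iff {n : ℕ} {N : Submodule ℂ (MvPolynomial (Fin 3) ℂ)} (hN : imageF n ≤ N)
    {a e c : ℕ} (h : a + 2 * e + c = n) :
    X 0 ^ a * X 1 ^ (2 * e) * X 2 ^ c ∈ N ↔ X 0 ^ (a + e) * X 2 ^ (c + e) ∈ N := by
  induction e generalizing a c with
  | zero => simp
  | succ e ih =>
    rw [mul_add, mul_one, monomial_succ_mem_iff hN (by omega), ih (by omega),
      show a + 1 + e = a + (e + 1) by omega, show c + 1 + e = c + (e + 1) by omega]

/-- Products of two generators, together with `F`-images, contain every form of degree `2 d`. -/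
lemma homogeneousSubmodule_le_of_mem {d : ℕ} {N : Submodule ℂ (MvPolynomial (Fin 3) ℂ)}
    (hN : imageF (2 * d) ≤ N) (h : ∀ m, X 0 ^ d * F2^[m] (X 0 ^ d) ∈ N) :
    homogeneousSubmodule (Fin 3) ℂ (2 * d) ≤ N := by
  have key : ∀ k ≤ d, X 0 ^ (2 * d - k) * X 2 ^ k ∈ N := by
    intro k hk
    have hle : weightSpan (2 * d) (2 * k) ≤
        imageF (2 * d) ⊔ Submodule.span ℂ {X 0 ^ (2 * d - k) * X 2 ^ k} := by
      refine monomialSpan_le fun a b c habc => ?_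
      obtain ⟨e, rfl⟩ : ∃ e, b = 2 * e := ⟨b / 2, by omega⟩
      rw [monomial_even_mem_iff le_sup_left habc.1, show a + e = 2 * d - k by omega,
        show c + e = k by omega]
      exact Submodule.mem_sup_right (Submodule.mem_span_singleton_self _)
    have hmem : X 0 ^ d * F2^[2 * k] (X 0 ^ d) ∈ weightSpan (2 * d) (2 * k) :=
      mul_mem_monomialSpan (by omega) (X_pow_mem_weightSpan d)
        (F2_iterate_X_pow_mem_weightSpan d (2 * k))
    obtain ⟨y, ⟨g, hgn, hg⟩, z, hz, hyz⟩ := Submodule.mem_sup.1 (hle hmem)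
    obtain ⟨r, rfl⟩ := Submodule.mem_span_singleton.1 hz
    have hr : r ≠ 0 := by
      rintro rfl
      rw [zero_smul, add_zero] at hyz
      exact X_pow_mul_F2_iterate_ne_F2 hk g (hyz.symm.trans hg.symm)
    have hy : y ∈ N := hN ⟨g, hgn, hg⟩
    rw [← N.smul_mem_iff hr, ← N.add_mem_iff_right hy, hyz]
    exact h _
  rw [homogeneousSubmodule_eq_monomialSpan]
  refine monomialSpan_le fun a b c habc => ?_
  obtain ⟨e, rfl | rfl⟩ := Nat.even_or_odd' b
  · by_cases hac : a < c
    · exact hN (monomial_mem_imageF_of_lt hac habc)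
    · rw [monomial_even_mem_iff hN habc, show a + e = 2 * d - (c + e) by omega]
      exact key _ (by omega)
  · exact hN (monomial_odd_mem_imageF habc)

lemma F2_iterate_eq_zero {n : ℕ} {f : MvPolynomial (Fin 3) ℂ} (hf : f.IsHomogeneous n) :
    F2^[2 * n + 1] f = 0 := by
  have hle : homogeneousSubmodule (Fin 3) ℂ n ≤
      LinearMap.ker ((F2 : MvPolynomial (Fin 3) ℂ →ₗ[ℂ] MvPolynomial (Fin 3) ℂ) ^ (2 * n + 1)) := by
    rw [homogeneousSubmodule_eq_monomialSpan]
    refine monomialSpan_le fun a b c h => ?_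
    have := F2_iterate_mem_weightSpan (n := n) (mem_monomialSpan ⟨h, rfl⟩) (2 * n + 1)
    rw [weightSpan_eq_bot (by omega), Submodule.mem_bot] at this
    rw [LinearMap.mem_ker, Module.End.pow_apply]
    exact this
  have := hle hf
  rwa [LinearMap.mem_ker, Module.End.pow_apply] at this

/-- The span of the pairwise products of the forms `F^m (x_0^d)`. -/
noncomputable def productSpan (d : ℕ) : Submodule ℂ (MvPolynomial (Fin 3) ℂ) :=
  Submodule.span ℂ {p | ∃ i j, p = F2^[i] (X 0 ^ d) * F2^[j] (X 0 ^ d)}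

lemma F2_mem_productSpan {d : ℕ} {f : MvPolynomial (Fin 3) ℂ} (hf : f ∈ productSpan d) :
    F2 f ∈ productSpan d := by
  suffices h : productSpan d ≤ (productSpan d).comap (F2 : _ →ₗ[ℂ] _) from h hf
  refine Submodule.span_le.2 ?_
  rintro _ ⟨i, j, rfl⟩
  simp only [Submodule.comap_coe, Set.mem_preimage, Derivation.coeFn_coe, Derivation.leibniz,
    ← Function.iterate_succ_apply', smul_eq_mul, SetLike.mem_coe]
  exact Submodule.add_mem _ (Submodule.subset_span ⟨i, j + 1, rfl⟩)
    (Submodule.subset_span ⟨j, i + 1, rfl⟩)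

lemma isHomogeneous_two_mul_mem_productSpan {d : ℕ} {f : MvPolynomial (Fin 3) ℂ}
    (hf : f.IsHomogeneous (2 * d)) : f ∈ productSpan d := by
  have hsplit : ∀ g : MvPolynomial (Fin 3) ℂ, g.IsHomogeneous (2 * d) →
      ∃ p ∈ productSpan d, ∃ h : MvPolynomial (Fin 3) ℂ, h.IsHomogeneous (2 * d) ∧
        g = p + F2 h := by
    intro g hg
    have hle := homogeneousSubmodule_le_of_mem (N := productSpan d ⊔ imageF (2 * d)) le_sup_right
      fun m => Submodule.mem_sup_left (Submodule.subset_span ⟨0, m, rfl⟩)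
    obtain ⟨p, hp, _, ⟨h, hh, rfl⟩, e⟩ := Submodule.mem_sup.1 (hle hg)
    exact ⟨p, hp, h, hh, e.symm⟩
  have hiter : ∀ m, ∃ p ∈ productSpan d, ∃ h : MvPolynomial (Fin 3) ℂ,
      h.IsHomogeneous (2 * d) ∧ f = p + F2^[m] h := by
    intro m
    induction m with
    | zero => exact ⟨0, Submodule.zero_mem _, f, hf, (zero_add f).symm⟩
    | succ m ih =>
      obtain ⟨p, hp, h, hh, e⟩ := ih
      obtain ⟨p', hp', h', hh', rfl⟩ := hsplit h hh
      have hmem : ∀ m, F2^[m] p' ∈ productSpan d := fun m => by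
        induction m with
        | zero => exact hp'
        | succ m ih => rw [Function.iterate_succ_apply']; exact F2_mem_productSpan ih
      refine ⟨p + F2^[m] p', Submodule.add_mem _ hp (hmem m), h', hh', ?_⟩
      rw [e, iterate_map_add, Function.iterate_succ_apply, add_assoc]
  obtain ⟨p, hp, h, hh, rfl⟩ := hiter (2 * (2 * d) + 1)
  rwa [F2_iterate_eq_zero hh, add_zero]

lemma F2_iterate_X_pow_modEq (m a : ℕ) :
    ∃ c : ℂ, c ≠ 0 ∧ ∃ g : MvPolynomial (Fin 3) ℂ,
      F2^[m] (X 0 ^ (a + m)) = C c * (X 0 ^ a * X 1 ^ m) + X 2 * g := by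
  induction m generalizing a with
  | zero => exact ⟨1, one_ne_zero, 0, by simp⟩
  | succ m ih =>
    obtain ⟨c, hc, g, h⟩ := ih (a + 1)
    have ha : (2 * (a + 1 : ℕ) : ℂ) ≠ 0 := by norm_cast
    refine ⟨c * (2 * (a + 1 : ℕ)), mul_ne_zero hc ha,
      C c * (C (m : ℂ) * X 0 ^ (a + 1) * X 1 ^ (m - 1)) + F2 g, ?_⟩
    have hF := F2_monomial (a + 1) m 0
    rw [pow_zero, mul_one] at hF
    rw [Function.iterate_succ_apply', show a + (m + 1) = a + 1 + m by omega, h, map_add,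
      ← smul_eq_C_mul, Derivation.map_smul, hF, Derivation.leibniz, F2_X_two]
    simp only [smul_eq_C_mul, smul_eq_mul, map_mul, add_tsub_cancel_right]
    ring

/-- The forms of degree `n` all of whose monomials are divisible by `(x_0 x_2)^j`. -/
noncomputable def divisibleSpan (n j : ℕ) : Submodule ℂ (MvPolynomial (Fin 3) ℂ) :=
  monomialSpan fun a b c => a + b + c = n ∧ j ≤ a ∧ j ≤ c

lemma X_zero_dvd_of_mem_divisibleSpan {n : ℕ} {t : MvPolynomial (Fin 3) ℂ}
    (ht : t ∈ divisibleSpan n 1) : X 0 ∣ t := by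
  suffices h : divisibleSpan n 1 ≤
      (Ideal.span {(X 0 : MvPolynomial (Fin 3) ℂ)}).restrictScalars ℂ from
    Ideal.mem_span_singleton.1 (h ht)
  refine monomialSpan_le fun a b c h => Ideal.mem_span_singleton.2 ?_
  exact dvd_mul_of_dvd_left (dvd_mul_of_dvd_left (dvd_pow_self _ (by omega)) _) _

lemma F2_iterate_middle (d : ℕ) : ∃ c : ℂ, c ≠ 0 ∧ ∃ t ∈ divisibleSpan d 1,
    F2^[d] (X 0 ^ d) = C c * X 1 ^ d + t := by
  have hle : weightSpan d d ≤ Submodule.span ℂ {X 1 ^ d} ⊔ divisibleSpan d 1 := by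
    refine monomialSpan_le fun a b c h => ?_
    rcases a with _ | a
    · obtain ⟨rfl, rfl⟩ : b = d ∧ c = 0 := by omega
      exact Submodule.mem_sup_left (by simp)
    · exact Submodule.mem_sup_right (mem_monomialSpan (by omega))
  obtain ⟨_, hy, t, ht, h⟩ := Submodule.mem_sup.1 (hle (F2_iterate_X_pow_mem_weightSpan d d))
  obtain ⟨r, rfl⟩ := Submodule.mem_span_singleton.1 hy
  rw [smul_eq_C_mul] at h
  refine ⟨r, ?_, t, ht, h.symm⟩
  rintro rfl
  obtain ⟨c, hc, g, hg⟩ := F2_iterate_X_pow_modEq d 0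
  obtain ⟨t', rfl⟩ := X_zero_dvd_of_mem_divisibleSpan ht
  rw [zero_add, ← h] at hg
  have := congrArg (aeval ![(0 : ℂ), 1, 0]) hg
  simp at this
  exact hc this.symm

lemma F2_iterate_last (d : ℕ) : ∃ c : ℂ, c ≠ 0 ∧ F2^[2 * d] (X 0 ^ d) = C c * X 2 ^ d := by
  have hle : weightSpan d (2 * d) ≤ Submodule.span ℂ {X 2 ^ d} := by
    refine monomialSpan_le fun a b c h => ?_
    obtain ⟨rfl, rfl, rfl⟩ : a = 0 ∧ b = 0 ∧ c = d := by omega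
    simp
  obtain ⟨r, h⟩ := Submodule.mem_span_singleton.1 (hle (F2_iterate_X_pow_mem_weightSpan d (2 * d)))
  rw [smul_eq_C_mul] at h
  refine ⟨r, ?_, h.symm⟩
  rintro rfl
  exact X_pow_mul_F2_iterate_ne_F2 (le_refl d) 0 (by simp [← h])

/-- The ideal generated by the forms `F^m (x_0^d)` with `m = 0, d, 2 d`. -/
noncomputable def paramIdeal (d : ℕ) : Ideal (MvPolynomial (Fin 3) ℂ) :=
  Ideal.span {X 0 ^ d, F2^[d] (X 0 ^ d), F2^[2 * d] (X 0 ^ d)}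

lemma C_mul_mem_iff {I : Ideal (MvPolynomial (Fin 3) ℂ)} {c : ℂ} (hc : c ≠ 0)
    {f : MvPolynomial (Fin 3) ℂ} : C c * f ∈ I ↔ f ∈ I :=
  I.unit_mul_mem_iff_mem ((isUnit_iff_ne_zero.2 hc).map C)

lemma X_pow_mem_paramIdeal (d : ℕ) : X 0 ^ d ∈ paramIdeal d ∧ X 2 ^ d ∈ paramIdeal d := by
  refine ⟨Ideal.subset_span (by simp), ?_⟩
  obtain ⟨c, hc, h⟩ := F2_iterate_last d
  rw [← C_mul_mem_iff hc, ← h]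
  exact Ideal.subset_span (by simp)

lemma monomial_mem_paramIdeal {d a b c : ℕ} (h : d ≤ a ∨ d ≤ c) :
    X 0 ^ a * X 1 ^ b * X 2 ^ c ∈ paramIdeal d := by
  rcases h with h | h
  · exact Ideal.mul_mem_right _ _ (Ideal.mul_mem_right _ _
      (Ideal.pow_mem_of_pow_mem _ (X_pow_mem_paramIdeal d).1 h))
  · exact Ideal.mul_mem_left _ _ (Ideal.pow_mem_of_pow_mem _ (X_pow_mem_paramIdeal d).2 h)

lemma divisibleSpan_le_paramIdeal {d n : ℕ} (hn : 3 * d ≤ n) (i j : ℕ)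
    (hij : d ≤ i + j) : divisibleSpan n j ≤ (paramIdeal d).restrictScalars ℂ := by
  induction i generalizing j with
  | zero => exact monomialSpan_le fun a b c h => monomial_mem_paramIdeal (by omega)
  | succ i ih =>
    refine monomialSpan_le fun a b c h => ?_
    by_cases hac : d ≤ a ∨ d ≤ c
    · exact monomial_mem_paramIdeal hac
    obtain ⟨b, rfl⟩ := Nat.exists_eq_add_of_le (show d ≤ b by omega)
    obtain ⟨r, hr, t, ht, hq⟩ := F2_iterate_middle d
    have hmem : t * (X 0 ^ a * X 1 ^ b * X 2 ^ c) ∈ divisibleSpan n (j + 1) :=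
      mul_mem_monomialSpan (Q := fun a b c => a + b + c + d = n ∧ j ≤ a ∧ j ≤ c) (by omega) ht
        (mem_monomialSpan (by omega))
    have hq' : F2^[d] (X 0 ^ d) ∈ paramIdeal d := Ideal.subset_span (by simp)
    rw [Submodule.restrictScalars_mem, ← C_mul_mem_iff hr]
    have e : C r * (X 0 ^ a * X 1 ^ (d + b) * X 2 ^ c) =
        F2^[d] (X 0 ^ d) * (X 0 ^ a * X 1 ^ b * X 2 ^ c) - t * (X 0 ^ a * X 1 ^ b * X 2 ^ c) := by
      rw [hq]
      ring
    rw [e]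
    exact Ideal.sub_mem _ (Ideal.mul_mem_right _ _ hq') (ih (j + 1) (by omega) hmem)

lemma exists_isHomogeneous_of_mem_paramIdeal {d e : ℕ} {f : MvPolynomial (Fin 3) ℂ}
    (hf : f.IsHomogeneous (d + e)) (h : f ∈ paramIdeal d) :
    ∃ u v w : MvPolynomial (Fin 3) ℂ, u.IsHomogeneous e ∧ v.IsHomogeneous e ∧ w.IsHomogeneous e ∧
      f = X 0 ^ d * u + F2^[d] (X 0 ^ d) * v + F2^[2 * d] (X 0 ^ d) * w := by
  obtain ⟨u, v, w, rfl⟩ := Submodule.mem_span_triple.1 h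
  refine ⟨homogeneousComponent e u, homogeneousComponent e v, homogeneousComponent e w,
    homogeneousComponent_isHomogeneous _ _, homogeneousComponent_isHomogeneous _ _,
    homogeneousComponent_isHomogeneous _ _, ?_⟩
  rw [← homogeneousComponent_mul_of_isHomogeneous (isHomogeneous_X_pow 0 d),
    ← homogeneousComponent_mul_of_isHomogeneous (isHomogeneous_F2_iterate_X_pow d d),
    ← homogeneousComponent_mul_of_isHomogeneous (isHomogeneous_F2_iterate_X_pow d (2 * d)),
    ← map_add, ← map_add, eq_comm]
  convert homogeneousComponent_eq_self hf using 2
  simp only [smul_eq_mul]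
  ring

lemma exists_eq_of_isHomogeneous {d e : ℕ} (he : 2 * d ≤ e)
    {f : MvPolynomial (Fin 3) ℂ} (hf : f.IsHomogeneous (d + e)) :
    ∃ u v w : MvPolynomial (Fin 3) ℂ, u.IsHomogeneous e ∧ v.IsHomogeneous e ∧ w.IsHomogeneous e ∧
      f = X 0 ^ d * u + F2^[d] (X 0 ^ d) * v + F2^[2 * d] (X 0 ^ d) * w := by
  refine exists_isHomogeneous_of_mem_paramIdeal hf
    (divisibleSpan_le_paramIdeal (n := d + e) (by omega) d 0 le_rfl ?_)
  have h := (homogeneousSubmodule_eq_monomialSpan (d + e)).le hf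
  exact monomialSpan_mono (fun a b c h => ⟨h, a.zero_le, c.zero_le⟩) h

lemma mem_of_X_one_pow_mul_mem {d N : ℕ} {f : MvPolynomial (Fin 3) ℂ}
    (h : X 1 ^ N * f ∈ Ideal.span {(X 0 ^ d : MvPolynomial (Fin 3) ℂ), X 2 ^ d}) :
    f ∈ Ideal.span {(X 0 ^ d : MvPolynomial (Fin 3) ℂ), X 2 ^ d} := by
  have e : ({X 0 ^ d, X 2 ^ d} : Set (MvPolynomial (Fin 3) ℂ)) =
      (fun s => monomial s (1 : ℂ)) '' {Finsupp.single 0 d, Finsupp.single 2 d} := by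
    rw [Set.image_pair, X_pow_eq_monomial, X_pow_eq_monomial]
  rw [e, mem_ideal_span_monomial_image] at h ⊢
  intro s hs
  have hs' : Finsupp.single 1 N + s ∈ (X 1 ^ N * f).support := by
    rw [mem_support_iff] at hs ⊢
    rwa [X_pow_eq_monomial, coeff_monomial_mul, one_mul]
  obtain ⟨t, ht, hle⟩ := h _ hs'
  refine ⟨t, ht, ?_⟩
  rcases ht with rfl | rfl <;>
  · rw [Finsupp.single_le_iff] at hle ⊢
    simpa using hle

lemma mem_of_F2_iterate_mul_mem {d : ℕ} {f : MvPolynomial (Fin 3) ℂ}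
    (h : F2^[d] (X 0 ^ d) * f ∈ Ideal.span {(X 0 ^ d : MvPolynomial (Fin 3) ℂ), X 2 ^ d}) :
    f ∈ Ideal.span {(X 0 ^ d : MvPolynomial (Fin 3) ℂ), X 2 ^ d} := by
  obtain ⟨c, hc, t, ht, hq⟩ := F2_iterate_middle d
  obtain ⟨t', rfl⟩ := X_zero_dvd_of_mem_divisibleSpan ht
  set I := Ideal.span {(X 0 ^ d : MvPolynomial (Fin 3) ℂ), X 2 ^ d}
  obtain ⟨g, hg⟩ := sub_dvd_pow_sub_pow (C c * X 1 ^ d) (-(X 0 * t')) d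
  have hX : (X 0 : MvPolynomial (Fin 3) ℂ) ^ d ∈ I := Ideal.subset_span (by simp)
  refine mem_of_X_one_pow_mul_mem (N := d * d) ?_
  rw [← C_mul_mem_iff (pow_ne_zero d hc)]
  have e : C (c ^ d) * (X 1 ^ (d * d) * f) =
      F2^[d] (X 0 ^ d) * f * g + X 0 ^ d * ((-t') ^ d * f) := by
    rw [hq, ← sub_neg_eq_add (C c * X 1 ^ d), mul_right_comm, ← hg, map_pow, pow_mul]
    rw [← mul_neg, mul_pow, mul_pow]
    ring
  rw [e]
  exact I.add_mem (I.mul_mem_right _ h) (I.mul_mem_right _ hX)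

/-- Syzygies of the three forms `F^m (x_0^d)`, `m = 0, d, 2 d`, are generated by the Koszul ones. -/
lemma exists_koszul {d : ℕ} {a b c : MvPolynomial (Fin 3) ℂ}
    (h : X 0 ^ d * a + F2^[d] (X 0 ^ d) * b + F2^[2 * d] (X 0 ^ d) * c = 0) :
    ∃ u v w : MvPolynomial (Fin 3) ℂ,
      a = F2^[d] (X 0 ^ d) * u + F2^[2 * d] (X 0 ^ d) * v ∧
      b = F2^[2 * d] (X 0 ^ d) * w - X 0 ^ d * u ∧
      c = -(X 0 ^ d * v) - F2^[d] (X 0 ^ d) * w := by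
  obtain ⟨r, hr, hlast⟩ := F2_iterate_last d
  have hrr : C r * C r⁻¹ = (1 : MvPolynomial (Fin 3) ℂ) := by
    rw [← map_mul, mul_inv_cancel₀ hr, map_one]
  rw [hlast] at h ⊢
  set q := F2^[d] (X 0 ^ d)
  have hmem : b ∈ Ideal.span {(X 0 ^ d : MvPolynomial (Fin 3) ℂ), X 2 ^ d} := by
    refine mem_of_F2_iterate_mul_mem (Ideal.mem_span_pair.2 ⟨-a, -(C r * c), ?_⟩)
    linear_combination -h
  obtain ⟨u, w, hb⟩ := Ideal.mem_span_pair.1 hmem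
  have hX0 : (X 0 ^ d : MvPolynomial (Fin 3) ℂ) ≠ 0 := pow_ne_zero _ (X_ne_zero 0)
  have hprime : ¬ (X 0 : MvPolynomial (Fin 3) ℂ) ∣ X 2 ^ d := fun hdvd => by
    have := X_prime.dvd_of_dvd_pow hdvd
    rw [X_dvd_X] at this
    exact absurd this (by decide)
  have hdvd : X 0 ^ d ∣ X 2 ^ d * (C r * c + q * w) := by
    refine ⟨-(a + q * u), ?_⟩
    linear_combination h + q * hb
  obtain ⟨v, hv⟩ := X_prime.pow_dvd_of_dvd_mul_left d hprime hdvd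
  refine ⟨-u, -(C r⁻¹ * v), C r⁻¹ * w, ?_, ?_, ?_⟩
  · refine mul_left_cancel₀ hX0 ?_
    linear_combination h + q * hb - X 2 ^ d * hv + X 0 ^ d * X 2 ^ d * v * hrr
  · linear_combination -hb - X 2 ^ d * w * hrr
  · linear_combination C r⁻¹ * hv - c * hrr

lemma exists_isHomogeneous_koszul {d e : ℕ} {a b c : MvPolynomial (Fin 3) ℂ}
    (ha : a.IsHomogeneous (d + e)) (hb : b.IsHomogeneous (d + e)) (hc : c.IsHomogeneous (d + e))
    (h : X 0 ^ d * a + F2^[d] (X 0 ^ d) * b + F2^[2 * d] (X 0 ^ d) * c = 0) :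
    ∃ u v w : MvPolynomial (Fin 3) ℂ,
      u.IsHomogeneous e ∧ v.IsHomogeneous e ∧ w.IsHomogeneous e ∧
      a = F2^[d] (X 0 ^ d) * u + F2^[2 * d] (X 0 ^ d) * v ∧
      b = F2^[2 * d] (X 0 ^ d) * w - X 0 ^ d * u ∧
      c = -(X 0 ^ d * v) - F2^[d] (X 0 ^ d) * w := by
  obtain ⟨u, v, w, h₁, h₂, h₃⟩ := exists_koszul h
  refine ⟨homogeneousComponent e u, homogeneousComponent e v, homogeneousComponent e w,
    homogeneousComponent_isHomogeneous _ _, homogeneousComponent_isHomogeneous _ _,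
    homogeneousComponent_isHomogeneous _ _, ?_⟩
  simp only [← homogeneousComponent_mul_of_isHomogeneous (isHomogeneous_X_pow (R := ℂ)
      (0 : Fin 3) d),
    ← homogeneousComponent_mul_of_isHomogeneous (isHomogeneous_F2_iterate_X_pow d d),
    ← homogeneousComponent_mul_of_isHomogeneous (isHomogeneous_F2_iterate_X_pow d (2 * d)),
    ← map_add, ← map_sub, ← map_neg, ← h₁, ← h₂, ← h₃]
  exact ⟨(homogeneousComponent_eq_self ha).symm, (homogeneousComponent_eq_self hb).symm,
    (homogeneousComponent_eq_self hc).symm⟩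

section Kernel

variable {d : ℕ} {φ : MvPolynomial (Fin (2 * d + 1)) ℂ →ₐ[ℂ] MvPolynomial (Fin 3) ℂ}

lemma isHomogeneous_map (hφ : ∀ m : Fin (2 * d + 1), φ (X m) = F2^[(m : ℕ)] (X 0 ^ d))
    {n : ℕ} {f : MvPolynomial (Fin (2 * d + 1)) ℂ} (hf : f.IsHomogeneous n) :
    (φ f).IsHomogeneous (d * n) := by
  rw [aeval_unique φ]
  refine hf.aeval _ fun m => ?_
  rw [Function.comp_apply, hφ]
  exact isHomogeneous_F2_iterate_X_pow d m

lemma homogeneousComponent_mem_ker (hd : 1 ≤ d)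
    (hφ : ∀ m : Fin (2 * d + 1), φ (X m) = F2^[(m : ℕ)] (X 0 ^ d))
    {f : MvPolynomial (Fin (2 * d + 1)) ℂ} (hf : φ f = 0) (n : ℕ) :
    φ (homogeneousComponent n f) = 0 := by
  have key : homogeneousComponent (d * n) (φ f) = φ (homogeneousComponent n f) := by
    have hcomp : ∀ i, homogeneousComponent (d * n) (φ (homogeneousComponent i f)) =
        if i = n then φ (homogeneousComponent n f) else 0 := fun i => by
      rw [homogeneousComponent_of_mem
        (isHomogeneous_map hφ (homogeneousComponent_isHomogeneous i f))]
      by_cases h : i = n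
      · simp [h]
      · rw [if_neg h, if_neg fun h' => h (Nat.eq_of_mul_eq_mul_left hd h').symm]
    conv_lhs => rw [← sum_homogeneousComponent f]
    rw [map_sum, map_sum, Finset.sum_congr rfl fun i _ => hcomp i, Finset.sum_ite_eq']
    split_ifs with h
    · rfl
    · rw [homogeneousComponent_eq_zero _ _ (by simpa using h), map_zero]
  rw [← key, hf, map_zero]

lemma exists_isHomogeneous_two_map_eq
    (hφ : ∀ m : Fin (2 * d + 1), φ (X m) = F2^[(m : ℕ)] (X 0 ^ d))
    {f : MvPolynomial (Fin 3) ℂ} (hf : f.IsHomogeneous (2 * d)) :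
    ∃ g : MvPolynomial (Fin (2 * d + 1)) ℂ, g.IsHomogeneous 2 ∧ φ g = f := by
  suffices h : productSpan d ≤
      (homogeneousSubmodule (Fin (2 * d + 1)) ℂ 2).map φ.toLinearMap from
    h (isHomogeneous_two_mul_mem_productSpan hf)
  refine Submodule.span_le.2 ?_
  rintro _ ⟨i, j, rfl⟩
  have hlift : ∀ i, ∃ y : MvPolynomial (Fin (2 * d + 1)) ℂ,
      y.IsHomogeneous 1 ∧ φ y = F2^[i] (X 0 ^ d) := fun i => by
    by_cases hi : i < 2 * d + 1
    · exact ⟨X ⟨i, hi⟩, isHomogeneous_X _ _, hφ _⟩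
    · have h0 := F2_iterate_X_pow_mem_weightSpan d i
      rw [weightSpan_eq_bot (by omega), Submodule.mem_bot] at h0
      exact ⟨0, isHomogeneous_zero _ _ _, by rw [h0, map_zero]⟩
  obtain ⟨y, hy, hyi⟩ := hlift i
  obtain ⟨z, hz, hzj⟩ := hlift j
  exact ⟨y * z, hy.mul hz, by simp [hyi, hzj]⟩

lemma exists_isHomogeneous_map_eq
    (hφ : ∀ m : Fin (2 * d + 1), φ (X m) = F2^[(m : ℕ)] (X 0 ^ d))
    {y₀ y₁ y₂ : MvPolynomial (Fin (2 * d + 1)) ℂ} (h₀ : y₀.IsHomogeneous 1)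
    (h₁ : y₁.IsHomogeneous 1) (h₂ : y₂.IsHomogeneous 1) (hy₀ : φ y₀ = X 0 ^ d)
    (hy₁ : φ y₁ = F2^[d] (X 0 ^ d)) (hy₂ : φ y₂ = F2^[2 * d] (X 0 ^ d))
    (k : ℕ) {f : MvPolynomial (Fin 3) ℂ} (hf : f.IsHomogeneous (d * (k + 2))) :
    ∃ g : MvPolynomial (Fin (2 * d + 1)) ℂ, g.IsHomogeneous (k + 2) ∧ φ g = f := by
  induction k generalizing f with
  | zero => exact exists_isHomogeneous_two_map_eq hφ (by simpa [mul_comm] using hf)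
  | succ k ih =>
    rw [show d * (k + 1 + 2) = d + d * (k + 2) by ring] at hf
    obtain ⟨u, v, w, hu, hv, hw, rfl⟩ := exists_eq_of_isHomogeneous (by nlinarith) hf
    obtain ⟨u, hu', rfl⟩ := ih hu
    obtain ⟨v, hv', rfl⟩ := ih hv
    obtain ⟨w, hw', rfl⟩ := ih hw
    refine ⟨y₀ * u + y₁ * v + y₂ * w, ?_, by simp [hy₀, hy₁, hy₂]⟩
    rw [show k + 1 + 2 = 1 + (k + 2) by ring]
    exact ((h₀.mul hu').add (h₁.mul hv')).add (h₂.mul hw')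

lemma mem_of_isHomogeneous_of_map_eq_zero
    (hφ : ∀ m : Fin (2 * d + 1), φ (X m) = F2^[(m : ℕ)] (X 0 ^ d))
    {J : Ideal (MvPolynomial (Fin (2 * d + 1)) ℂ)}
    (hJ : ∀ n ≤ 3, ∀ f : MvPolynomial (Fin (2 * d + 1)) ℂ, f.IsHomogeneous n → φ f = 0 → f ∈ J)
    (hJker : ∀ f ∈ J, φ f = 0)
    {n : ℕ} {f : MvPolynomial (Fin (2 * d + 1)) ℂ} (hf : f.IsHomogeneous n) (hf0 : φ f = 0) :
    f ∈ J := by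
  induction n using Nat.strong_induction_on generalizing f with
  | _ n ih =>
  by_cases hn : n ≤ 3
  · exact hJ n hn f hf hf0
  obtain ⟨k, rfl⟩ : ∃ k, n = k + 2 + 1 + 1 := ⟨n - 4, by omega⟩
  obtain ⟨y₀, h₀, hy₀⟩ : ∃ y : MvPolynomial (Fin (2 * d + 1)) ℂ,
      y.IsHomogeneous 1 ∧ φ y = X 0 ^ d := ⟨X 0, isHomogeneous_X _ _, by rw [hφ]; rfl⟩
  obtain ⟨y₁, h₁, hy₁⟩ : ∃ y : MvPolynomial (Fin (2 * d + 1)) ℂ,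
      y.IsHomogeneous 1 ∧ φ y = F2^[d] (X 0 ^ d) :=
    ⟨X ⟨d, by omega⟩, isHomogeneous_X _ _, by rw [hφ]⟩
  obtain ⟨y₂, h₂, hy₂⟩ : ∃ y : MvPolynomial (Fin (2 * d + 1)) ℂ,
      y.IsHomogeneous 1 ∧ φ y = F2^[2 * d] (X 0 ^ d) :=
    ⟨X ⟨2 * d, by omega⟩, isHomogeneous_X _ _, by rw [hφ]⟩
  have lift {p : MvPolynomial (Fin 3) ℂ} (hp : p.IsHomogeneous (d * (k + 2))) :=
    exists_isHomogeneous_map_eq hφ h₀ h₁ h₂ hy₀ hy₁ hy₂ k hp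
  have hdeg : k + 2 + 1 = 1 + (k + 2) := by ring
  have hmem : ∀ {g : MvPolynomial (Fin (2 * d + 1)) ℂ}, g.IsHomogeneous (k + 2 + 1) →
      φ g = 0 → g ∈ J := fun hg hg0 => ih (k + 2 + 1) (by omega) hg hg0
  let R := homogeneousSubmodule (Fin (2 * d + 1)) ℂ (k + 2 + 1)
  let T := R.map (LinearMap.mulLeft ℂ y₀) ⊔ R.map (LinearMap.mulLeft ℂ y₁) ⊔
    R.map (LinearMap.mulLeft ℂ y₂) ⊔ J.restrictScalars ℂ
  have hX : ∀ i, ∀ g ∈ R, X i * g ∈ T := by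
    intro i g hg
    have hg' := isHomogeneous_map hφ hg
    rw [show d * (k + 2 + 1) = d + d * (k + 2) by ring] at hg'
    obtain ⟨u, v, w, hu, hv, hw, e⟩ := exists_eq_of_isHomogeneous (by nlinarith) hg'
    obtain ⟨u, hu', rfl⟩ := lift hu
    obtain ⟨v, hv', rfl⟩ := lift hv
    obtain ⟨w, hw', rfl⟩ := lift hw
    have hker : g - (y₀ * u + y₁ * v + y₂ * w) ∈ J := by
      refine hmem (hg.sub ?_) (by simp [e, hy₀, hy₁, hy₂])
      rw [hdeg]
      exact ((h₀.mul hu').add (h₁.mul hv')).add (h₂.mul hw')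
    have hXR : ∀ p : MvPolynomial (Fin (2 * d + 1)) ℂ, p.IsHomogeneous (k + 2) → X i * p ∈ R :=
      fun p hp => by
        change (X i * p).IsHomogeneous _
        rw [hdeg]
        exact (isHomogeneous_X _ i).mul hp
    rw [show X i * g = y₀ * (X i * u) + y₁ * (X i * v) + y₂ * (X i * w)
      + X i * (g - (y₀ * u + y₁ * v + y₂ * w)) by ring]
    exact Submodule.add_mem_sup (Submodule.add_mem_sup (Submodule.add_mem_sup
      (Submodule.mem_map_of_mem (hXR u hu')) (Submodule.mem_map_of_mem (hXR v hv')))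
      (Submodule.mem_map_of_mem (hXR w hw'))) (J.mul_mem_left _ hker)
  have hfT : f ∈ T := by
    rw [f.as_sum]
    refine Submodule.sum_mem _ fun s hs => ?_
    have hsdeg := hf.degree_eq_sum_deg_support hs
    obtain ⟨i, hi⟩ : ∃ i, s i ≠ 0 := by
      by_contra! h
      obtain rfl : s = 0 := Finsupp.ext h
      simp at hsdeg
    have hs' : Finsupp.single i 1 + (s - Finsupp.single i 1) = s :=
      add_tsub_cancel_of_le (Finsupp.single_le_iff.2 (Nat.one_le_iff_ne_zero.2 hi))
    rw [← hs', ← one_mul (coeff _ f), ← monomial_mul]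
    refine hX i _ (isHomogeneous_monomial _ ?_)
    have hd' := congrArg Finsupp.degree hs'
    rw [map_add, Finsupp.degree_single] at hd'
    have : s.degree = k + 2 + 1 + 1 := hsdeg.symm
    omega
  obtain ⟨p, hp, j, hj, rfl⟩ := Submodule.mem_sup.1 hfT
  obtain ⟨q, hq, _, ⟨c, hc, rfl⟩, rfl⟩ := Submodule.mem_sup.1 hp
  obtain ⟨_, ⟨a, ha, rfl⟩, _, ⟨b, hb, rfl⟩, rfl⟩ := Submodule.mem_sup.1 hq
  simp only [LinearMap.mulLeft_apply] at hf0 ⊢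
  have hφR : ∀ g ∈ R, (φ g).IsHomogeneous (d + d * (k + 2)) := fun g hg => by
    rw [show d + d * (k + 2) = d * (k + 2 + 1) by ring]
    exact isHomogeneous_map hφ hg
  rw [map_add, hJker j hj, add_zero, map_add, map_add, map_mul, map_mul, map_mul, hy₀, hy₁,
    hy₂] at hf0
  obtain ⟨u, v, w, hu, hv, hw, eu, ev, ew⟩ :=
    exists_isHomogeneous_koszul (hφR a ha) (hφR b hb) (hφR c hc) hf0
  obtain ⟨u, hu', rfl⟩ := lift hu
  obtain ⟨v, hv', rfl⟩ := lift hv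
  obtain ⟨w, hw', rfl⟩ := lift hw
  have hmul : ∀ {y p : MvPolynomial (Fin (2 * d + 1)) ℂ}, y.IsHomogeneous 1 →
      p.IsHomogeneous (k + 2) → (y * p).IsHomogeneous (k + 2 + 1) := fun hy hp => by
    rw [hdeg]
    exact hy.mul hp
  have hA : a - (y₁ * u + y₂ * v) ∈ J :=
    hmem (IsHomogeneous.sub ha ((hmul h₁ hu').add (hmul h₂ hv'))) (by simp [eu, hy₁, hy₂])
  have hB : b - (y₂ * w - y₀ * u) ∈ J :=
    hmem (IsHomogeneous.sub hb ((hmul h₂ hw').sub (hmul h₀ hu'))) (by simp [ev, hy₀, hy₂])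
  have hC : c - (-(y₀ * v) - y₁ * w) ∈ J :=
    hmem (IsHomogeneous.sub hc ((hmul h₀ hv').neg.sub (hmul h₁ hw'))) (by simp [ew, hy₀, hy₁])
  rw [show y₀ * a + y₁ * b + y₂ * c + j = y₀ * (a - (y₁ * u + y₂ * v)) +
    y₁ * (b - (y₂ * w - y₀ * u)) + y₂ * (c - (-(y₀ * v) - y₁ * w)) + j by ring]
  exact J.add_mem (J.add_mem (J.add_mem (J.mul_mem_left _ hA) (J.mul_mem_left _ hB))
    (J.mul_mem_left _ hC)) hj

end Kernel

/-- The kernel of the algebra map `φ : ℂ[y_0,…,y_{2d}] → ℂ[x_0,x_1,x_2]`, `y_m ↦ F^m(x_0^d)`,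
is generated as an ideal by its homogeneous elements of degree at most `3`. -/
theorem ker_generated_in_low_degree (d : ℕ) (hd : 1 ≤ d)
    (φ : MvPolynomial (Fin (2 * d + 1)) ℂ →ₐ[ℂ] MvPolynomial (Fin 3) ℂ)
    (hφ : ∀ m : Fin (2 * d + 1), φ (X m) = (fun p => F2 p)^[(m : ℕ)] (X 0 ^ d)) :
    RingHom.ker φ =
      Ideal.span {p : MvPolynomial (Fin (2 * d + 1)) ℂ |
        p ∈ RingHom.ker φ ∧ ∃ n : ℕ, n ≤ 3 ∧ p.IsHomogeneous n} := by
  set J := Ideal.span {p : MvPolynomial (Fin (2 * d + 1)) ℂ |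
    p ∈ RingHom.ker φ ∧ ∃ n : ℕ, n ≤ 3 ∧ p.IsHomogeneous n}
  have hJker : J ≤ RingHom.ker φ := Ideal.span_le.2 fun f hf => hf.1
  refine le_antisymm (fun f hf => ?_) hJker
  rw [← sum_homogeneousComponent f]
  refine Ideal.sum_mem _ fun n _ => ?_
  exact mem_of_isHomogeneous_of_map_eq_zero (J := J) hφ
    (fun n hn f hf hf0 => Ideal.subset_span ⟨hf0, n, hn, hf⟩) (fun f hf => hJker hf)
    (homogeneousComponent_isHomogeneous n f) (homogeneousComponent_mem_ker hd hφ hf n)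
end
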